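/- arXiv:2605.18116 — 6 statements merged into one kernel-verified Lean document; each statement's English description precedes it below -/
import Mathlib

section
/- Let K be a field of characteristic zero and let G be a weakly Noetherian Lie algebra over K. Then the intersection over all k ≥ 0 of the derived series D^k G equals the intersection over all k ≥ 1 of the lower central series C^k [G,G] of the derived ideal [G,G]; that is, ⋂_k D^k G = ⋂_k C^k [G,G]. -/
/-- A Lie algebra is weakly Noetherian if `m/[m,m]` is finite dimensional over `K` for every
Lie subalgebra `m`. -/
def WeaklyNoetherian (K G : Type*) [Field K] [LieRing G] [LieAlgebra K G] : Prop :=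
  ∀ m : LieSubalgebra K G,
    FiniteDimensional K (↥m ⧸ LieAlgebra.derivedSeries K ↥m 1)

/-- The lower central series of a Lie ideal `I`, viewed inside the ambient Lie algebra:
`C¹ I = I` and `C^{k+1} I = ⁅I, C^k I⁆` (here indexed from `0`). -/
def lcsOfIdeal (K G : Type*) [Field K] [LieRing G] [LieAlgebra K G]
    (I : LieIdeal K G) : ℕ → LieIdeal K G
  | 0 => I
  | k + 1 => ⁅I, lcsOfIdeal K G I k⁆

open LieAlgebra TensorProduct

section Lie

variable {K L V : Type*} [Field K] [CharZero K] [LieRing L] [LieAlgebra K L]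
  [AddCommGroup V] [Module K V] [LieRingModule L V] [LieModule K L V] [FiniteDimensional K V]
  [IsSolvable L]

/-- A nonzero finite-dimensional module over a solvable Lie algebra `L` over an algebraically
closed field of characteristic zero is not generated by the action of `[L, L]`. -/
theorem lie_derivedSeries_one_top_ne_top_of_isAlgClosed [IsAlgClosed K] [Nontrivial V] :
    ⁅derivedSeries K L 1, (⊤ : LieSubmodule K L V)⁆ ≠ ⊤ := by
  intro htop
  obtain ⟨χ, hχ⟩ :=
    LieModule.exists_nontrivial_weightSpace_of_isSolvable K L (Module.Dual K V)
  obtain ⟨⟨f, hf⟩, hf0⟩ := exists_ne (0 : LieModule.weightSpace (Module.Dual K V) χ)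
  rw [LieModule.mem_weightSpace] at hf
  replace hf0 : f ≠ 0 := by simpa using hf0
  have hχD : (derivedSeries K L 1).toSubmodule ≤ LinearMap.ker χ := by
    have hspan := coe_derivedSeries_one_eq K L
    rw [LieIdeal.toLieSubalgebra_toSubmodule] at hspan
    rw [hspan, Submodule.span_le]
    rintro _ ⟨x, y, rfl⟩
    have hzero : χ ⁅x, y⁆ • f = 0 := by
      rw [← hf, lie_lie, hf y, hf x, lie_smul, lie_smul, hf x, hf y, smul_comm, sub_self]
    exact (smul_eq_zero.mp hzero).resolve_right hf0
  have hker : (⁅derivedSeries K L 1, (⊤ : LieSubmodule K L V)⁆).toSubmodule ≤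
      LinearMap.ker f := by
    rw [LieSubmodule.lieIdeal_oper_eq_linear_span', Submodule.span_le]
    rintro _ ⟨x, hx, m, -, rfl⟩
    have hxf := congrArg (fun g : Module.Dual K V => g m) (hf x)
    have hχx : χ x = 0 := hχD hx
    simpa [hχx] using hxf
  rw [htop, LieSubmodule.top_toSubmodule, top_le_iff, LinearMap.ker_eq_top] at hker
  exact hf0 hker

/-- A nonzero finite-dimensional module over a solvable Lie algebra `L` over a field of
characteristic zero is not generated by the action of `[L, L]`. -/
theorem lie_derivedSeries_one_top_ne_top [Nontrivial V] :
    ⁅derivedSeries K L 1, (⊤ : LieSubmodule K L V)⁆ ≠ ⊤ := by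
  intro htop
  let A := AlgebraicClosure K
  have : CharZero A := algebraRat.charZero A
  apply lie_derivedSeries_one_top_ne_top_of_isAlgClosed (K := A) (L := A ⊗[K] L) (V := A ⊗[K] V)
  rw [derivedSeries_baseChange, ← LieSubmodule.baseChange_top, ← LieSubmodule.lie_baseChange, htop]

/-- For a solvable Lie algebra `L` over a field of characteristic zero, a submodule
`N` of a finite-dimensional module with `[[L, L], N] = N` vanishes. -/
theorem LieSubmodule.eq_bot_of_lie_derivedSeries_one_eq {N : LieSubmodule K L V}
    (hN : ⁅derivedSeries K L 1, N⁆ = N) : N = ⊥ := by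
  by_contra hne
  have : Nontrivial N := (LieSubmodule.nontrivial_iff_ne_bot K L V).mpr hne
  apply lie_derivedSeries_one_top_ne_top (K := K) (L := L) (V := N)
  apply LieSubmodule.map_injective_of_injective (f := N.incl) N.injective_incl
  rw [LieSubmodule.map_bracket_eq]
  simpa using hN

end Lie

section lcsOfIdeal

variable {K G : Type*} [Field K] [LieRing G] [LieAlgebra K G]

theorem antitone_lcsOfIdeal (I : LieIdeal K G) : Antitone (lcsOfIdeal K G I) :=
  antitone_nat_of_succ_le fun _ => LieSubmodule.lie_le_right _ _

theorem map_lcsOfIdeal_le {H : Type*} [LieRing H] [LieAlgebra K H] (f : G →ₗ⁅K⁆ H)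
    {I : LieIdeal K G} {J : LieIdeal K H} (hIJ : I.map f ≤ J) (n : ℕ) :
    (lcsOfIdeal K G I n).map f ≤ lcsOfIdeal K H J n := by
  induction n with
  | zero => exact hIJ
  | succ n ih => exact (LieIdeal.map_bracket_le f).trans (LieSubmodule.mono_lie hIJ ih)

theorem derivedSeries_succ_le_lcsOfIdeal (n : ℕ) :
    derivedSeries K G (n + 1) ≤ lcsOfIdeal K G (derivedSeries K G 1) n := by
  induction n with
  | zero => exact le_rfl
  | succ n ih =>
    rw [derivedSeries_def, derivedSeriesOfIdeal_succ]
    exact LieSubmodule.mono_lie (derivedSeriesOfIdeal_antitone ⊤ (by omega)) ih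

/-- The derived ideal of a finite-dimensional solvable Lie algebra over a field of characteristic
zero is nilpotent. -/
theorem exists_lcsOfIdeal_derivedSeries_one_eq_bot [CharZero K] [FiniteDimensional K G]
    [IsSolvable G] : ∃ n, lcsOfIdeal K G (derivedSeries K G 1) n = ⊥ := by
  have hwf : WellFoundedGT (LieSubmodule K G G)ᵒᵈ :=
    LieSubmodule.wellFoundedLT_of_isArtinian K G G
  obtain ⟨n, hn⟩ := hwf.monotone_chain_condition
    ⟨_, antitone_lcsOfIdeal (derivedSeries K G 1)⟩
  exact ⟨n, LieSubmodule.eq_bot_of_lie_derivedSeries_one_eq (hn (n + 1) n.le_succ).symm⟩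

end lcsOfIdeal

namespace WeaklyNoetherian

variable {K G : Type*} [Field K] [LieRing G] [LieAlgebra K G]

theorem finiteDimensional_quotient_derivedSeries (hG : WeaklyNoetherian K G) (k : ℕ) :
    FiniteDimensional K (G ⧸ derivedSeries K G k) := by
  induction k with
  | zero =>
    have : Subsingleton (G ⧸ derivedSeries K G 0) :=
      Submodule.Quotient.subsingleton_iff.mpr rfl
    infer_instance
  | succ k ih =>
    let I := derivedSeries K G k
    let J := derivedSeries K G (k + 1)
    have hJI : J.toSubmodule ≤ I.toSubmodule := derivedSeriesOfIdeal_succ_le ⊤ k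
    have hfin : FiniteDimensional K (I ⧸ derivedSeries K I 1) := hG I.toLieSubalgebra
    have hle : (derivedSeries K I 1).toSubmodule ≤ J.toSubmodule.comap I.toSubmodule.subtype := by
      rw [LieIdeal.derivedSeries_eq_derivedSeriesOfIdeal_comap]
      intro x hx
      have hx' : (x : G) ∈ derivedSeriesOfIdeal K G 1 I := LieIdeal.mem_comap.mp hx
      have hIJ : derivedSeriesOfIdeal K G 1 I = J := by
        rw [← derivedSeriesOfIdeal_add, Nat.add_comm]
      exact hIJ ▸ hx'
    let φ : (I ⧸ (derivedSeries K I 1).toSubmodule) →ₗ[K] G ⧸ J.toSubmodule :=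
      Submodule.mapQ _ _ I.toSubmodule.subtype hle
    have hrange : I.toSubmodule.map J.toSubmodule.mkQ = LinearMap.range φ := by
      rw [Submodule.range_mapQ, Submodule.range_subtype]
    have hsub : FiniteDimensional K (I.toSubmodule.map J.toSubmodule.mkQ) := by
      rw [hrange]
      exact Module.Finite.range φ
    have hquot : FiniteDimensional K
        ((G ⧸ J.toSubmodule) ⧸ I.toSubmodule.map J.toSubmodule.mkQ) :=
      have : FiniteDimensional K (G ⧸ I.toSubmodule) := ih
      Module.Finite.equiv
        (Submodule.quotientQuotientEquivQuotient J.toSubmodule I.toSubmodule hJI).symm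
    exact Module.Finite.of_submodule_quotient (I.toSubmodule.map J.toSubmodule.mkQ)

theorem exists_lcsOfIdeal_le_derivedSeries [CharZero K] (hG : WeaklyNoetherian K G) (k : ℕ) :
    ∃ n, lcsOfIdeal K G (derivedSeries K G 1) n ≤ derivedSeries K G k := by
  let I := derivedSeries K G k
  let π : G →ₗ⁅K⁆ G ⧸ I :=
    { (LieSubmodule.Quotient.mk' I : G →ₗ[K] G ⧸ I) with
      map_lie' := fun {x y} => LieSubmodule.Quotient.mk_bracket I x y }
  have hπ : Function.Surjective π := LieSubmodule.Quotient.surjective_mk' I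
  have := hG.finiteDimensional_quotient_derivedSeries k
  have : IsSolvable (G ⧸ I) := by
    apply IsSolvable.mk (R := K) (k := k)
    rw [← LieIdeal.derivedSeries_map_eq k hπ, LieIdeal.map_eq_bot_iff]
    intro x hx
    exact (LieSubmodule.Quotient.mk_eq_zero I).mpr hx
  obtain ⟨n, hn⟩ := exists_lcsOfIdeal_derivedSeries_one_eq_bot (K := K) (G := G ⧸ I)
  refine ⟨n, fun x hx => (LieSubmodule.Quotient.mk_eq_zero I).mp ?_⟩
  have hmem := map_lcsOfIdeal_le π (LieIdeal.derivedSeries_map_le 1) n (LieIdeal.mem_map hx)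
  rwa [hn] at hmem

end WeaklyNoetherian

/-- For a weakly Noetherian Lie algebra `G`, the intersection of the derived
series of `G` equals the intersection of the lower central series of the derived ideal
`[G,G]`. -/
theorem weaklyNoetherian_iInf_derivedSeries_eq_iInf_lowerCentralSeries
    (K G : Type*) [Field K] [CharZero K] [LieRing G] [LieAlgebra K G]
    (hG : WeaklyNoetherian K G) :
    (⨅ k : ℕ, LieAlgebra.derivedSeries K G k) =
      ⨅ k : ℕ, lcsOfIdeal K G (LieAlgebra.derivedSeries K G 1) k := by
  apply le_antisymm
  · exact le_iInf fun n => (iInf_le _ (n + 1)).trans (derivedSeries_succ_le_lcsOfIdeal n)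
  · refine le_iInf fun k => ?_
    obtain ⟨n, hn⟩ := hG.exists_lcsOfIdeal_le_derivedSeries k
    exact (iInf_le _ n).trans hn
end

section
/- Let K be a field of characteristic zero and let G be a weakly Noetherian Lie algebra over K which is perfect (G = [G,G]). Let m be a Lie ideal of G of finite codimension (the quotient vector space G/m is finite-dimensional over K). Then the intersection of the derived series of m equals the intersection of the lower central series of m: ⋂_k D^k m = ⋂_k C^k m. -/
open LieModule LieAlgebra Module
open scoped TensorProduct

/-- Over an algebraically closed field of characteristic zero, a solvable ideal of a perfect Lie
algebra acts by nilpotent endomorphisms on every finite-dimensional module. -/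
theorem isNilpotent_toEnd_of_mem_solvable_ideal_of_isAlgClosed
    {K L : Type*} [Field K] [IsAlgClosed K] [CharZero K] [LieRing L] [LieAlgebra K L]
    (hperfect : derivedSeries K L 1 = ⊤) (I : LieIdeal K L) [IsSolvable I] {x : L} (hx : x ∈ I)
    (M : Type*) [AddCommGroup M] [Module K M] [LieRingModule L M] [LieModule K L M]
    [FiniteDimensional K M] :
    IsNilpotent (toEnd K L M x) := by
  induction hn : finrank K M using Nat.strong_induction_on generalizing M with
  | _ n ih =>
  obtain _ | _ := subsingleton_or_nontrivial M
  · exact ⟨1, Subsingleton.elim _ _⟩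
  obtain ⟨χ, hχ⟩ := exists_nontrivial_weightSpace_of_isSolvable K I M
  let N : LieSubmodule K L M := weightSpaceOfIsLieTower K M χ
  have hN : Nontrivial N := hχ
  have hpos : 0 < finrank K N := finrank_pos
  have hscalar (v : M) (hv : v ∈ N) : ⁅x, v⁆ = χ ⟨x, hx⟩ • v :=
    (mem_weightSpace χ v).mp hv ⟨x, hx⟩
  have htrace : LinearMap.trace K N (toEnd K L N x) = 0 := by
    refine trace_toEnd_eq_zero_of_mem_lcs K L N (k := 1) le_rfl ?_
    have : lowerCentralSeries K L L 1 = ⊤ := hperfect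
    exact this ▸ LieSubmodule.mem_top x
  have hχx : χ ⟨x, hx⟩ = 0 := by
    have hend : toEnd K L N x = χ ⟨x, hx⟩ • LinearMap.id := by
      ext v
      exact hscalar v v.2
    rw [hend] at htrace
    simpa [hpos.ne'] using htrace
  obtain ⟨j, hj⟩ := ih (finrank K (M ⧸ N))
    (by
      have := N.toSubmodule.finrank_quotient_add_finrank
      change finrank K (M ⧸ N) + finrank K N = _ at this
      omega) (M ⧸ N) rfl
  refine ⟨j + 1, ?_⟩
  ext v
  have hmk (i : ℕ) (w : M) : LieSubmodule.Quotient.mk' N ((toEnd K L M x ^ i) w) =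
      (toEnd K L (M ⧸ N) x ^ i) (LieSubmodule.Quotient.mk' N w) := by
    induction i with
    | zero => simp
    | succ i ih' => rw [pow_succ', pow_succ', Module.End.mul_apply, Module.End.mul_apply, ← ih',
        toEnd_apply_apply, toEnd_apply_apply, LieModuleHom.map_lie]
  have hmem : (toEnd K L M x ^ j) v ∈ N := by
    rw [← LieSubmodule.Quotient.mk_eq_zero, hmk, hj, LinearMap.zero_apply]
  rw [pow_succ', Module.End.mul_apply, toEnd_apply_apply, hscalar _ hmem, hχx, zero_smul,
    LinearMap.zero_apply]

/-- Over a field of characteristic zero, a solvable ideal of a perfect Lie algebra acts by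
nilpotent endomorphisms on every finite-dimensional module. -/
theorem isNilpotent_toEnd_of_mem_solvable_ideal
    {K L : Type*} [Field K] [CharZero K] [LieRing L] [LieAlgebra K L]
    (hperfect : derivedSeries K L 1 = ⊤) (I : LieIdeal K L) [IsSolvable I] {x : L} (hx : x ∈ I)
    (M : Type*) [AddCommGroup M] [Module K M] [LieRingModule L M] [LieModule K L M]
    [FiniteDimensional K M] :
    IsNilpotent (toEnd K L M x) := by
  let A := AlgebraicClosure K
  have hA : derivedSeries A (A ⊗[K] L) 1 = ⊤ := by
    rw [derivedSeries_baseChange, hperfect, LieSubmodule.baseChange_top]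
  have : IsSolvable (I.baseChange A) := by
    obtain ⟨k, hk⟩ := IsSolvable.solvable K I
    rw [LieIdeal.derivedSeries_eq_bot_iff] at hk
    refine IsSolvable.mk (R := A) (k := k) ((LieIdeal.derivedSeries_eq_bot_iff _ k).mpr ?_)
    rw [derivedSeriesOfIdeal_baseChange, hk, LieSubmodule.baseChange_bot]
  have hnil := isNilpotent_toEnd_of_mem_solvable_ideal_of_isAlgClosed hA (I.baseChange A)
    (LieSubmodule.tmul_mem_baseChange_of_mem 1 hx) (A ⊗[K] M)
  have hinj : Function.Injective (End.baseChangeHom K A M) :=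
    LinearMap.baseChangeHom_injective K M A
  rw [← IsNilpotent.map_iff hinj]
  rwa [toEnd_baseChange] at hnil

/-- The derived series of an ideal commutes with surjective homomorphisms. -/
theorem derivedSeriesOfIdeal_map_eq {R L L' : Type*} [CommRing R] [LieRing L] [LieAlgebra R L]
    [LieRing L'] [LieAlgebra R L'] (f : L →ₗ⁅R⁆ L') (hf : Function.Surjective f)
    (I : LieIdeal R L) (k : ℕ) :
    derivedSeriesOfIdeal R L' k (I.map f) = (derivedSeriesOfIdeal R L k I).map f := by
  induction k with
  | zero => rfl
  | succ k ih =>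
    rw [derivedSeriesOfIdeal_succ, derivedSeriesOfIdeal_succ, ih, LieIdeal.map_bracket_eq f hf]

/-- The projection of a Lie algebra onto its quotient by an ideal. -/
def lieQuotientMk {R L : Type*} [CommRing R] [LieRing L] [LieAlgebra R L] (J : LieIdeal R L) :
    L →ₗ⁅R⁆ L ⧸ J :=
  { (LieSubmodule.Quotient.mk' J : L →ₗ[R] L ⧸ J) with map_lie' := rfl }

theorem lieQuotientMk_surjective {R L : Type*} [CommRing R] [LieRing L] [LieAlgebra R L]
    (J : LieIdeal R L) : Function.Surjective (lieQuotientMk J) :=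
  LieSubmodule.Quotient.surjective_mk' J

/-- In a weakly Noetherian Lie algebra the terms of the derived series of an ideal of finite
codimension have finite codimension. -/
theorem WeaklyNoetherian.finiteDimensional_quotient_derivedSeriesOfIdeal
    {K G : Type*} [Field K] [LieRing G] [LieAlgebra K G] (hG : WeaklyNoetherian K G)
    (m : LieIdeal K G) (hcodim : FiniteDimensional K (G ⧸ m)) (k : ℕ) :
    FiniteDimensional K (G ⧸ derivedSeriesOfIdeal K G k m) := by
  induction k with
  | zero => exact hcodim
  | succ k ih =>
    set I := derivedSeriesOfIdeal K G k m
    set J := derivedSeriesOfIdeal K G (k + 1) m with hJ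
    have hJI_eq : J = derivedSeriesOfIdeal K G 1 I := by
      rw [hJ, add_comm, derivedSeriesOfIdeal_add]
    have hJI : J ≤ I := derivedSeriesOfIdeal_succ_le m k
    let f : I →ₗ[K] G ⧸ J.toSubmodule := J.toSubmodule.mkQ ∘ₗ I.toSubmodule.subtype
    let g : (G ⧸ J.toSubmodule) →ₗ[K] G ⧸ I.toSubmodule := Submodule.factor hJI
    have hfin : FiniteDimensional K (I ⧸ (derivedSeries K I 1).toSubmodule) :=
      hG (I : LieSubalgebra K G)
    have hker : (derivedSeries K I 1).toSubmodule ≤ LinearMap.ker f := by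
      intro x hx
      rw [LieSubmodule.mem_toSubmodule, LieIdeal.derivedSeries_eq_derivedSeriesOfIdeal_comap,
        LieIdeal.mem_comap, ← hJI_eq] at hx
      exact (Submodule.Quotient.mk_eq_zero _).mpr hx
    have hrange : FiniteDimensional K (LinearMap.range f) := by
      rw [← Submodule.range_liftQ _ f hker]
      infer_instance
    have hkerg : LinearMap.ker g = LinearMap.range f := by
      apply le_antisymm
      · intro y hy
        obtain ⟨y, rfl⟩ := Submodule.mkQ_surjective _ y
        exact ⟨⟨y, (Submodule.Quotient.mk_eq_zero _).mp hy⟩, rfl⟩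
      · rintro _ ⟨y, rfl⟩
        exact (Submodule.Quotient.mk_eq_zero _).mpr y.2
    have hquot : FiniteDimensional K ((G ⧸ J.toSubmodule) ⧸ LinearMap.ker g) := by
      have : FiniteDimensional K (G ⧸ I.toSubmodule) := ih
      exact Module.Finite.equiv g.quotKerEquivRange.symm
    have hker' : FiniteDimensional K (LinearMap.ker g) := hkerg ▸ hrange
    exact Module.Finite.of_submodule_quotient (LinearMap.ker g)

/-- In a perfect Lie algebra of characteristic zero, a term of the derived series of an ideal `m`
that has finite codimension contains a term of the lower central series of `m`. -/
theorem exists_lcsOfIdeal_le_derivedSeriesOfIdeal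
    {K G : Type*} [Field K] [CharZero K] [LieRing G] [LieAlgebra K G]
    (hperfect : derivedSeries K G 1 = ⊤) (m : LieIdeal K G) (k : ℕ)
    [FiniteDimensional K (G ⧸ derivedSeriesOfIdeal K G k m)] :
    ∃ j, lcsOfIdeal K G m j ≤ derivedSeriesOfIdeal K G k m := by
  set J := derivedSeriesOfIdeal K G k m
  let π := lieQuotientMk J
  have hπ : Function.Surjective π := lieQuotientMk_surjective J
  have hquot : derivedSeries K (G ⧸ J) 1 = ⊤ := by
    rw [← LieIdeal.derivedSeries_map_eq 1 hπ, hperfect, ← LieHom.idealRange_eq_map,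
      LieHom.idealRange_eq_top_of_surjective π hπ]
  have hsolv : IsSolvable (m.map π) := by
    refine IsSolvable.mk (R := K) (k := k) ((LieIdeal.derivedSeries_eq_bot_iff _ k).mpr ?_)
    rw [derivedSeriesOfIdeal_map_eq π hπ, LieIdeal.map_eq_bot_iff]
    exact fun x hx ↦ LieHom.mem_ker.mpr ((LieSubmodule.Quotient.mk_eq_zero (N := J)).mpr hx)
  have hnil : IsNilpotent m (G ⧸ J) := by
    rw [isNilpotent_iff_forall' (R := K)]
    intro x
    exact isNilpotent_toEnd_of_mem_solvable_ideal hquot (m.map π)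
      (LieIdeal.mem_map x.2) (G ⧸ J)
  obtain ⟨j, hj⟩ := (isNilpotent_iff K m (G ⧸ J)).mp hnil
  have hmk (i : ℕ) (y : G) (hy : y ∈ lcsOfIdeal K G m i) :
      π y ∈ lowerCentralSeries K m (G ⧸ J) i := by
    induction i generalizing y with
    | zero => simp
    | succ i ih =>
      suffices h : (⁅m, lcsOfIdeal K G m i⁆ : LieIdeal K G).toSubmodule ≤
          (lowerCentralSeries K m (G ⧸ J) (i + 1)).toSubmodule.comap (π : G →ₗ[K] G ⧸ J) from h hy
      rw [LieSubmodule.lieIdeal_oper_eq_linear_span', Submodule.span_le]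
      rintro _ ⟨a, ha, b, hb, rfl⟩
      rw [lowerCentralSeries_succ]
      exact LieSubmodule.lie_mem_lie (x := (⟨a, ha⟩ : m)) (LieSubmodule.mem_top _) (ih b hb)
  refine ⟨j, fun y hy ↦ ?_⟩
  have := hmk j y hy
  rw [hj, LieSubmodule.mem_bot] at this
  exact (LieSubmodule.Quotient.mk_eq_zero (N := J)).mp this

theorem derivedSeriesOfIdeal_le_lcsOfIdeal {K G : Type*} [Field K] [LieRing G] [LieAlgebra K G]
    (m : LieIdeal K G) (k : ℕ) : derivedSeriesOfIdeal K G k m ≤ lcsOfIdeal K G m k := by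
  induction k with
  | zero => exact le_rfl
  | succ k ih =>
    rw [derivedSeriesOfIdeal_succ]
    exact LieSubmodule.mono_lie (derivedSeriesOfIdeal_le_self m k) ih

/-- Let `G` be a perfect weakly Noetherian Lie algebra and let `m` be a Lie
ideal of finite codimension. Then the intersection of the derived series of `m` equals the
intersection of the lower central series of `m`. -/
theorem weaklyNoetherian_perfect_iInf_derived_eq_iInf_lcs_of_ideal
    (K G : Type*) [Field K] [CharZero K] [LieRing G] [LieAlgebra K G]
    (hG : WeaklyNoetherian K G)
    (hperfect : LieAlgebra.derivedSeries K G 1 = ⊤)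
    (m : LieIdeal K G)
    (hcodim : FiniteDimensional K (G ⧸ m)) :
    (⨅ k : ℕ, LieAlgebra.derivedSeriesOfIdeal K G k m) =
      ⨅ k : ℕ, lcsOfIdeal K G m k := by
  refine le_antisymm (iInf_mono (derivedSeriesOfIdeal_le_lcsOfIdeal m)) (le_iInf fun k ↦ ?_)
  have := hG.finiteDimensional_quotient_derivedSeriesOfIdeal m hcodim k
  obtain ⟨j, hj⟩ := exists_lcsOfIdeal_le_derivedSeriesOfIdeal hperfect m k
  exact (iInf_le _ j).trans hj
end

section
/- Let K be a field of characteristic zero, let G be a weakly Noetherian Lie algebra over K, and let m be a Lie ideal of G. Define the finite closure Cl_G(m) as the supremum (sum) of all Lie ideals r of G with m ⊆ r such that the quotient vector space r/m is finite-dimensional over K. Then (a) the quotient Cl_G(m)/m is finite-dimensional over K, and (b) Cl_G(m) is a characteristic ideal of G, i.e. D(Cl_G(m)) ⊆ Cl_G(m) for every K-linear derivation D of G. -/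
/-- The finite closure of a Lie ideal `m`: the sum of all Lie ideals `r ⊇ m` such that
`r/m` (equivalently, the image of `r` in `G/m`) is finite dimensional. -/
def finiteClosure (K G : Type*) [Field K] [LieRing G] [LieAlgebra K G]
    (m : LieIdeal K G) : LieIdeal K G :=
  sSup {r : LieIdeal K G | m ≤ r ∧
    FiniteDimensional K (Submodule.map (m : Submodule K G).mkQ (r : Submodule K G))}

section LinearAlgebra

variable {K V W : Type*} [Field K] [AddCommGroup V] [Module K V] [AddCommGroup W] [Module K W]

/-- A subspace with finite-dimensional image under `f` is spanned, modulo the kernel of `f`, by a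
finite-dimensional subspace of itself. -/
theorem Submodule.exists_fg_le_sup_ker (s : Submodule K V) (f : V →ₗ[K] W)
    (h : FiniteDimensional K (s.map f)) :
    ∃ N ≤ s, N.FG ∧ s ≤ N ⊔ LinearMap.ker f := by
  obtain ⟨t, ht⟩ := Module.Finite.iff_fg.mp h
  have hts : (t : Set W) ⊆ f '' (s : Set V) := by
    rw [← Submodule.map_coe, ← ht]
    exact Submodule.subset_span
  classical
  obtain ⟨u, hu, rfl⟩ := Finset.subset_set_image_iff.mp hts
  refine ⟨Submodule.span K u, Submodule.span_le.mpr hu, ⟨u, rfl⟩, ?_⟩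
  rw [← Submodule.comap_map_eq, ← Submodule.map_le_iff_le_comap, ← ht, Finset.coe_image,
    Submodule.map_span]

end LinearAlgebra

section FiniteClosure

variable {K G : Type*} [Field K] [LieRing G] [LieAlgebra K G]

/-- A linear map that vanishes on the brackets of a subalgebra of a weakly Noetherian Lie algebra
maps this subalgebra to a finite-dimensional space. -/
theorem WeaklyNoetherian.finite_map {V : Type*} [AddCommGroup V] [Module K V]
    (hG : WeaklyNoetherian K G) (A : LieSubalgebra K G) (f : G →ₗ[K] V)
    (hf : ∀ x ∈ A, ∀ y ∈ A, f ⁅x, y⁆ = 0) : FiniteDimensional K (A.toSubmodule.map f) := by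
  let g : A →ₗ[K] V := f ∘ₗ A.toSubmodule.subtype
  have hle : (LieAlgebra.derivedSeries K A 1).toSubmodule ≤ LinearMap.ker g := by
    rw [LieAlgebra.derivedSeries_def, LieAlgebra.derivedSeriesOfIdeal_succ,
      LieAlgebra.derivedSeriesOfIdeal_zero, LieSubmodule.lieIdeal_oper_eq_linear_span,
      Submodule.span_le]
    rintro _ ⟨x, y, rfl⟩
    exact hf x x.1.2 y y.1.2
  have : FiniteDimensional K (A ⧸ (LieAlgebra.derivedSeries K A 1).toSubmodule) := hG A
  have hrange : LinearMap.range g = A.toSubmodule.map f := by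
    ext v
    exact ⟨fun ⟨x, hx⟩ => ⟨x, x.2, hx⟩, fun ⟨x, hx, hv⟩ => ⟨⟨x, hx⟩, hv⟩⟩
  rw [← hrange, ← Submodule.range_liftQ _ g hle]
  infer_instance

/-- A subspace containing `m` and abelian modulo `m` is a finite extension of `m`. -/
theorem WeaklyNoetherian.finite_map_mkQ_of_lie_mem (hG : WeaklyNoetherian K G) (m : LieIdeal K G)
    (A : Submodule K G) (hmA : m.toSubmodule ≤ A) (hA : ∀ x ∈ A, ∀ y ∈ A, ⁅x, y⁆ ∈ m) :
    FiniteDimensional K (A.map m.toSubmodule.mkQ) := by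
  let A' : LieSubalgebra K G := { A with lie_mem' := fun {x y} hx hy => hmA (hA x hx y hy) }
  exact hG.finite_map A' m.toSubmodule.mkQ fun x hx y hy =>
    (Submodule.Quotient.mk_eq_zero _).mpr (hA x hx y hy)

/-- `r` is an ideal containing `m` with `r / m` finite-dimensional. -/
def IsFiniteExtension (m r : LieIdeal K G) : Prop :=
  m ≤ r ∧ FiniteDimensional K (r.toSubmodule.map m.toSubmodule.mkQ)

theorem IsFiniteExtension.refl (m : LieIdeal K G) : IsFiniteExtension m m := by
  refine ⟨le_rfl, ?_⟩
  rw [Submodule.mkQ_map_self]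
  infer_instance

theorem IsFiniteExtension.sup {m r s : LieIdeal K G} (hr : IsFiniteExtension m r)
    (hs : IsFiniteExtension m s) : IsFiniteExtension m (r ⊔ s) := by
  refine ⟨hr.1.trans le_sup_left, ?_⟩
  have := hr.2
  have := hs.2
  rw [LieSubmodule.sup_toSubmodule, Submodule.map_sup]
  infer_instance

theorem IsFiniteExtension.trans {m r s : LieIdeal K G} (hr : IsFiniteExtension m r)
    (hs : IsFiniteExtension r s) : IsFiniteExtension m s := by
  refine ⟨hr.1.trans hs.1, ?_⟩
  obtain ⟨N, -, hN, hle⟩ := s.toSubmodule.exists_fg_le_sup_ker _ hs.2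
  rw [Submodule.ker_mkQ] at hle
  have := hr.2
  have : FiniteDimensional K (N.map m.toSubmodule.mkQ) := Module.Finite.iff_fg.mpr (hN.map _)
  have hfin : FiniteDimensional K ((N ⊔ r.toSubmodule).map m.toSubmodule.mkQ) := by
    rw [Submodule.map_sup]
    infer_instance
  exact Submodule.finiteDimensional_of_le (Submodule.map_mono hle)

theorem IsFiniteExtension.le_finiteClosure {m r : LieIdeal K G} (hr : IsFiniteExtension m r) :
    r ≤ finiteClosure K G m :=
  le_sSup hr

theorem mem_finiteClosure {m : LieIdeal K G} {x : G} :
    x ∈ finiteClosure K G m ↔ ∃ r, IsFiniteExtension m r ∧ x ∈ r := by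
  refine ⟨fun hx => ?_, fun ⟨r, hr, hx⟩ => hr.le_finiteClosure hx⟩
  let U : LieIdeal K G :=
    { carrier := {x | ∃ r, IsFiniteExtension m r ∧ x ∈ r}
      zero_mem' := ⟨m, .refl m, zero_mem m⟩
      add_mem' := by
        rintro a b ⟨r, hr, ha⟩ ⟨s, hs, hb⟩
        exact ⟨r ⊔ s, hr.sup hs,
          add_mem ((le_sup_left : r ≤ r ⊔ s) ha) ((le_sup_right : s ≤ r ⊔ s) hb)⟩
      smul_mem' := by
        rintro c a ⟨r, hr, ha⟩
        exact ⟨r, hr, r.smul_mem c ha⟩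
      lie_mem := by
        rintro a b ⟨r, hr, hb⟩
        exact ⟨r, hr, r.lie_mem hb⟩ }
  exact (sSup_le fun r hr y hy => ⟨r, hr, hy⟩ : finiteClosure K G m ≤ U) hx

theorem Submodule.FG.exists_isFiniteExtension {m : LieIdeal K G} {N : Submodule K G} (hN : N.FG)
    (hle : N ≤ (finiteClosure K G m).toSubmodule) :
    ∃ r, IsFiniteExtension m r ∧ N ≤ r.toSubmodule := by
  induction N, hN using Submodule.fg_induction with
  | singleton x =>
    obtain ⟨r, hr, hx⟩ := mem_finiteClosure.mp (hle (Submodule.mem_span_singleton_self x))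
    exact ⟨r, hr, (Submodule.span_singleton_le_iff_mem _ _).mpr hx⟩
  | sup M₁ M₂ _ _ h₁ h₂ =>
    obtain ⟨r, hr, hMr⟩ := h₁ (le_sup_left.trans hle)
    obtain ⟨s, hs, hMs⟩ := h₂ (le_sup_right.trans hle)
    refine ⟨r ⊔ s, hr.sup hs, ?_⟩
    rw [LieSubmodule.sup_toSubmodule]
    exact sup_le_sup hMr hMs

/-- Among the subspaces of `C` containing `m` and abelian modulo `m` there is a maximal one. -/
theorem exists_maximal_lie_mem (m C : LieIdeal K G) (hmC : m ≤ C) :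
    ∃ A : Submodule K G, m.toSubmodule ≤ A ∧
      Maximal (fun A => A ≤ C.toSubmodule ∧ ∀ x ∈ A, ∀ y ∈ A, ⁅x, y⁆ ∈ m) A := by
  refine zorn_le_nonempty₀ {A : Submodule K G | A ≤ C.toSubmodule ∧ ∀ x ∈ A, ∀ y ∈ A, ⁅x, y⁆ ∈ m}
    (fun c hc hchain B hB => ⟨sSup c, ⟨sSup_le fun A hA => (hc hA).1, ?_⟩, fun A => le_sSup⟩)
    m.toSubmodule ⟨hmC, fun x _ y hy => m.lie_mem hy⟩
  intro x hx y hy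
  rw [Submodule.mem_sSup_of_directed ⟨B, hB⟩ hchain.directedOn] at hx hy
  obtain ⟨A₁, hA₁, hx⟩ := hx
  obtain ⟨A₂, hA₂, hy⟩ := hy
  obtain ⟨A, hA, h₁, h₂⟩ := hchain.directedOn A₁ hA₁ A₂ hA₂
  exact (hc hA).2 x (h₁ hx) y (h₂ hy)

theorem WeaklyNoetherian.isFiniteExtension_finiteClosure (hG : WeaklyNoetherian K G)
    (m : LieIdeal K G) : IsFiniteExtension m (finiteClosure K G m) := by
  have hmC := (IsFiniteExtension.refl m).le_finiteClosure
  refine ⟨hmC, ?_⟩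
  obtain ⟨A, hmA, ⟨hAC, hA⟩, hmax⟩ := exists_maximal_lie_mem m _ hmC
  have hAfin := hG.finite_map_mkQ_of_lie_mem m A hmA hA
  obtain ⟨N, hNA, hN, hAN⟩ := A.exists_fg_le_sup_ker _ hAfin
  rw [Submodule.ker_mkQ] at hAN
  obtain ⟨r, hr, hNr⟩ := hN.exists_isFiniteExtension (hNA.trans hAC)
  have := hr.2
  have : FiniteDimensional K N := Module.Finite.iff_fg.mpr hN
  -- The elements centralizing `A` modulo `m` form the kernel of a map to a
  -- finite-dimensional space.
  let f : G →ₗ[K] N →ₗ[K] r.toSubmodule.map m.toSubmodule.mkQ :=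
    LinearMap.mk₂ K
      (fun g x => ⟨m.toSubmodule.mkQ ⁅g, (x : G)⁆,
        Submodule.mem_map_of_mem (r.lie_mem (hNr x.2))⟩)
      (fun _ _ _ => Subtype.ext (by simp))
      (fun _ _ _ => Subtype.ext (by simp))
      (fun _ _ _ => Subtype.ext (by simp))
      (fun _ _ _ => Subtype.ext (by simp))
  have hker : ∀ z, f z = 0 → ∀ a ∈ A, ⁅z, a⁆ ∈ m := by
    intro z hz a ha
    obtain ⟨n, hn, y, hy, rfl⟩ := Submodule.mem_sup.mp (hAN ha)
    rw [lie_add]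
    refine add_mem ((Submodule.Quotient.mk_eq_zero m.toSubmodule).mp ?_) (m.lie_mem hy)
    exact congrArg Subtype.val (LinearMap.congr_fun hz ⟨n, hn⟩)
  have hkerA : ∀ z ∈ finiteClosure K G m, f z = 0 → z ∈ A := by
    intro z hzC hz
    refine hmax (y := A ⊔ Submodule.span K {z}) ⟨sup_le hAC ?_, ?_⟩ le_sup_left
      (Submodule.mem_sup_right (Submodule.mem_span_singleton_self z))
    · exact (Submodule.span_singleton_le_iff_mem _ _).mpr hzC
    · intro x hx y hy
      obtain ⟨a, ha, _, hs, rfl⟩ := Submodule.mem_sup.mp hx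
      obtain ⟨b, hb, _, ht, rfl⟩ := Submodule.mem_sup.mp hy
      obtain ⟨s, rfl⟩ := Submodule.mem_span_singleton.mp hs
      obtain ⟨t, rfl⟩ := Submodule.mem_span_singleton.mp ht
      have haz : ⁅a, z⁆ ∈ m := by
        rw [← lie_skew]
        exact neg_mem (hker z hz a ha)
      simp only [add_lie, lie_add, smul_lie, lie_smul, lie_self, smul_zero, add_zero]
      exact add_mem (add_mem (hA a ha b hb) (m.smul_mem s (hker z hz b hb)))
        (m.smul_mem t haz)
  obtain ⟨W, hWC, hW, hCW⟩ :=
    (finiteClosure K G m).toSubmodule.exists_fg_le_sup_ker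
      (W := N →ₗ[K] r.toSubmodule.map m.toSubmodule.mkQ) f inferInstance
  have hle : (finiteClosure K G m).toSubmodule ≤ W ⊔ A := by
    intro c hc
    obtain ⟨w, hw, z, hz, rfl⟩ := Submodule.mem_sup.mp (hCW hc)
    exact add_mem (Submodule.mem_sup_left hw) (Submodule.mem_sup_right
      (hkerA z ((Submodule.add_mem_iff_right _ (hWC hw)).mp hc) hz))
  have : FiniteDimensional K (W.map m.toSubmodule.mkQ) := Module.Finite.iff_fg.mpr (hW.map _)
  have hfin : FiniteDimensional K ((W ⊔ A).map m.toSubmodule.mkQ) := by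
    rw [Submodule.map_sup]
    infer_instance
  exact Submodule.finiteDimensional_of_le (Submodule.map_mono hle)

/-- The ideal `C + D(C)` generated by an ideal `C` and its image under a derivation `D`. -/
def LieDerivation.supMap (D : LieDerivation K G G) (C : LieIdeal K G) : LieIdeal K G :=
  { C.toSubmodule ⊔ C.toSubmodule.map D.toLinearMap with
    lie_mem := by
      rintro g x hx
      obtain ⟨a, ha, _, ⟨b, hb, rfl⟩, rfl⟩ := Submodule.mem_sup.mp hx
      have h : ⁅g, a + D b⁆ = (⁅g, a⁆ - ⁅D g, b⁆) + D ⁅g, b⁆ := by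
        rw [lie_add, D.apply_lie_eq_add]
        abel
      exact h ▸ add_mem (Submodule.mem_sup_left (sub_mem (C.lie_mem ha) (C.lie_mem hb)))
        (Submodule.mem_sup_right (Submodule.mem_map_of_mem (C.lie_mem hb))) }

theorem WeaklyNoetherian.isFiniteExtension_supMap (hG : WeaklyNoetherian K G) (C : LieIdeal K G)
    (D : LieDerivation K G G) : IsFiniteExtension C (D.supMap C) := by
  refine ⟨fun x hx => Submodule.mem_sup_left hx, ?_⟩
  have hfin : FiniteDimensional K (C.toSubmodule.map (C.toSubmodule.mkQ ∘ₗ D.toLinearMap)) :=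
    hG.finite_map (C.toLieSubalgebra K G) _ fun x hx y hy => by
      refine (Submodule.Quotient.mk_eq_zero _).mpr ?_
      change D ⁅x, y⁆ ∈ C
      rw [D.apply_lie_eq_add]
      exact add_mem (lie_mem_left K G C _ _ hx) (C.lie_mem hy)
  rw [Submodule.map_comp] at hfin
  change FiniteDimensional K
    ((C.toSubmodule ⊔ C.toSubmodule.map D.toLinearMap).map C.toSubmodule.mkQ)
  rwa [Submodule.map_sup, Submodule.mkQ_map_self, bot_sup_eq]

end FiniteClosure

/-- In a weakly Noetherian Lie algebra, for every Lie ideal `m`: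
(a) the finite closure `Cl_G(m)` is a finite-dimensional extension of `m`, and
(b) `Cl_G(m)` is a characteristic ideal. -/
theorem weaklyNoetherian_finiteClosure_finite_and_characteristic
    (K G : Type*) [Field K] [CharZero K] [LieRing G] [LieAlgebra K G]
    (hG : WeaklyNoetherian K G) (m : LieIdeal K G) :
    FiniteDimensional K
      (Submodule.map (m : Submodule K G).mkQ (finiteClosure K G m : Submodule K G)) ∧
    (∀ D : LieDerivation K G G, ∀ x ∈ finiteClosure K G m, D x ∈ finiteClosure K G m) := by
  have hC := hG.isFiniteExtension_finiteClosure m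
  refine ⟨hC.2, fun D x hx => ?_⟩
  exact (hC.trans (hG.isFiniteExtension_supMap _ D)).le_finiteClosure
    (Submodule.mem_sup_right (Submodule.mem_map_of_mem hx))
end

section
/- Let K be a field of characteristic zero and let G be a weakly Noetherian Lie algebra over K. Then the centroid Cent(G), viewed as a K-linear subspace of End_K(G), is finite-dimensional over K. -/
/-- The centroid of a Lie algebra: the space of `K`-linear endomorphisms `θ` with
`θ ⁅x, y⁆ = ⁅x, θ y⁆` for all `x, y`. -/
def centroid (K G : Type*) [Field K] [LieRing G] [LieAlgebra K G] :
    Submodule K (G →ₗ[K] G) where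
  carrier := {θ | ∀ x y : G, θ ⁅x, y⁆ = ⁅x, θ y⁆}
  add_mem' := fun {θ θ'} hθ hθ' x y => by
    simp only [LinearMap.add_apply, hθ x y, hθ' x y, lie_add]
  zero_mem' := fun x y => by simp
  smul_mem' := fun c θ hθ x y => by
    simp only [LinearMap.smul_apply, hθ x y, lie_smul]

section

variable {K G : Type*} [Field K] [LieRing G] [LieAlgebra K G]

/-- In a weakly Noetherian Lie algebra every subspace of commuting elements is finite
dimensional. -/
theorem WeaklyNoetherian.finiteDimensional_of_lie_eq_zero (hG : WeaklyNoetherian K G)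
    (P : Submodule K G) (hP : ∀ a ∈ P, ∀ b ∈ P, ⁅a, b⁆ = 0) : FiniteDimensional K P := by
  let m : LieSubalgebra K G :=
    { P with lie_mem' := fun {a b} ha hb => (hP a ha b hb).symm ▸ P.zero_mem }
  have : IsLieAbelian m := ⟨fun a b => Subtype.ext (hP a a.2 b b.2)⟩
  have hbot : LieAlgebra.derivedSeries K m 1 = ⊥ :=
    LieSubmodule.trivial_lie_oper_zero (⊤ : LieIdeal K m) ⊤
  have hfin := hG m
  rw [hbot] at hfin
  refine Module.Finite.of_injective (M := m) (N := m ⧸ (⊥ : LieIdeal K m))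
    (Submodule.mkQ (⊥ : Submodule K m)) ?_
  rw [← LinearMap.ker_eq_bot]
  exact Submodule.ker_mkQ _

theorem centroid_apply_lie {θ : G →ₗ[K] G} (hθ : θ ∈ centroid K G) (x y : G) :
    θ ⁅x, y⁆ = ⁅x, θ y⁆ :=
  hθ x y

theorem centroid_apply_lie_left {θ : G →ₗ[K] G} (hθ : θ ∈ centroid K G) (x y : G) :
    θ ⁅x, y⁆ = ⁅θ x, y⁆ := by
  rw [← lie_skew, map_neg, centroid_apply_lie hθ, lie_skew]

/-- The orbit of an element under the centroid of a weakly Noetherian Lie algebra is finite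
dimensional, because its elements commute. -/
theorem WeaklyNoetherian.finiteDimensional_centroid_orbit (hG : WeaklyNoetherian K G) (x : G) :
    FiniteDimensional K ((centroid K G).map (LinearMap.applyₗ x : (G →ₗ[K] G) →ₗ[K] G)) := by
  apply hG.finiteDimensional_of_lie_eq_zero
  rintro _ ⟨θ, hθ, rfl⟩ _ ⟨φ, hφ, rfl⟩
  change ⁅θ x, φ x⁆ = 0
  rw [← centroid_apply_lie hφ, ← centroid_apply_lie_left hθ, lie_self, map_zero, map_zero]

/-- The centroid of a weakly Noetherian Lie algebra is finite dimensional if its elements are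
determined by their restrictions to some finite-dimensional subspace. -/
theorem WeaklyNoetherian.finiteDimensional_centroid_of_separating (hG : WeaklyNoetherian K G)
    (F : Submodule K G) (hF : F.FG)
    (h : ∀ θ ∈ centroid K G, (∀ x ∈ F, θ x = 0) → θ = 0) :
    FiniteDimensional K (centroid K G) := by
  obtain ⟨T, rfl⟩ := hF
  have := hG.finiteDimensional_centroid_orbit
  let f : centroid K G →ₗ[K] ∀ t : T,
      (centroid K G).map (LinearMap.applyₗ (t : G) : (G →ₗ[K] G) →ₗ[K] G) :=
    LinearMap.pi fun t =>
      (LinearMap.applyₗ (t : G) : (G →ₗ[K] G) →ₗ[K] G).submoduleMap (centroid K G)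
  refine Module.Finite.of_injective f ?_
  rw [← LinearMap.ker_eq_bot, LinearMap.ker_eq_bot']
  intro θ hθ
  refine Subtype.ext (h θ θ.2 fun x hx => ?_)
  have hle : Submodule.span K (T : Set G) ≤ LinearMap.ker (θ : G →ₗ[K] G) :=
    Submodule.span_le.mpr fun t ht => congrArg Subtype.val (congrFun hθ ⟨t, ht⟩)
  exact hle hx

/-- There is a set of pairwise commuting elements which contains every element commuting with all
of its members. -/
theorem exists_maximal_commuting_set (L : Type*) [LieRing L] :
    ∃ S : Set L, (∀ a ∈ S, ∀ b ∈ S, ⁅a, b⁆ = 0) ∧ ∀ z, (∀ a ∈ S, ⁅a, z⁆ = 0) → z ∈ S := by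
  obtain ⟨S, hS⟩ := zorn_subset {S : Set L | ∀ a ∈ S, ∀ b ∈ S, ⁅a, b⁆ = 0} (by
    refine fun c hc hchain => ⟨⋃₀ c, ?_, fun s hs => Set.subset_sUnion_of_mem hs⟩
    rintro a ⟨s, hs, ha⟩ b ⟨t, ht, hb⟩
    rcases hchain.total hs ht with hst | hts
    · exact hc ht a (hst ha) b hb
    · exact hc hs a ha b (hts hb))
  refine ⟨S, hS.prop, fun z hz => ?_⟩
  refine hS.le_of_ge (y := insert z S) ?_ (Set.subset_insert z S) (Set.mem_insert z S)
  rintro a (rfl | ha) b (rfl | hb)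
  · exact lie_self _
  · rw [← lie_skew, hz b hb, neg_zero]
  · exact hz a ha
  · exact hS.prop a ha b hb

theorem lie_eq_zero_of_mem_span {S : Set G} (hS : ∀ a ∈ S, ∀ b ∈ S, ⁅a, b⁆ = 0) :
    ∀ a ∈ Submodule.span K S, ∀ b ∈ Submodule.span K S, ⁅a, b⁆ = 0 := by
  intro a ha b hb
  induction ha, hb using Submodule.span_induction₂ with
  | mem_mem x y hx hy => exact hS x hx y hy
  | zero_left => exact zero_lie _
  | zero_right => exact lie_zero _
  | add_left x y z _ _ _ h h' => rw [add_lie, h, h', add_zero]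
  | add_right x y z _ _ _ h h' => rw [lie_add, h, h', add_zero]
  | smul_left r x y _ _ h => rw [smul_lie, h, smul_zero]
  | smul_right r x y _ _ h => rw [lie_smul, h, smul_zero]

/-- The ideal spanned by the images of the elements of the centroid that vanish on a set `S`. -/
def centroidAnnihilatorImage (K : Type*) {G : Type*} [Field K] [LieRing G] [LieAlgebra K G]
    (S : Set G) : LieIdeal K G where
  __ := Submodule.span K {z | ∃ θ ∈ centroid K G, (∀ s ∈ S, θ s = 0) ∧ ∃ y, θ y = z}
  lie_mem {x m} hm := by
    change m ∈ Submodule.span K _ at hm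
    change ⁅x, m⁆ ∈ Submodule.span K _
    induction hm using Submodule.span_induction with
    | mem z hz =>
      obtain ⟨θ, hθ, hS, y, rfl⟩ := hz
      exact Submodule.subset_span ⟨θ, hθ, hS, ⁅x, y⁆, centroid_apply_lie hθ x y⟩
    | zero => rw [lie_zero]; exact Submodule.zero_mem _
    | add a b _ _ ha hb => rw [lie_add]; exact Submodule.add_mem _ ha hb
    | smul r a _ ha => rw [lie_smul]; exact Submodule.smul_mem _ r ha

theorem apply_mem_centroidAnnihilatorImage {S : Set G} {θ : G →ₗ[K] G} (hθ : θ ∈ centroid K G)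
    (hS : ∀ s ∈ S, θ s = 0) (y : G) : θ y ∈ centroidAnnihilatorImage K S :=
  Submodule.subset_span (R := K) ⟨θ, hθ, hS, y, rfl⟩

theorem centroidAnnihilatorImage_le_span {S : Set G}
    (hS : ∀ z, (∀ a ∈ S, ⁅a, z⁆ = 0) → z ∈ S) :
    (centroidAnnihilatorImage K S).toSubmodule ≤ Submodule.span K S := by
  refine Submodule.span_mono ?_
  rintro _ ⟨θ, hθ, hann, y, rfl⟩
  refine hS _ fun a ha => ?_
  rw [← centroid_apply_lie hθ, centroid_apply_lie_left hθ, hann a ha, zero_lie]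

/-- A subspace with finite-dimensional quotient has a finitely generated complement. -/
theorem Submodule.exists_fg_sup_eq_top {V : Type*} [AddCommGroup V] [Module K V]
    (D : Submodule K V) [FiniteDimensional K (V ⧸ D)] :
    ∃ F : Submodule K V, F.FG ∧ D ⊔ F = ⊤ := by
  obtain ⟨F, hF⟩ := D.exists_isCompl
  have : FiniteDimensional K F :=
    Module.Finite.equiv (Submodule.quotientEquivOfIsCompl D F hF)
  exact ⟨F, Module.Finite.iff_fg.mp this, hF.sup_eq_top⟩

theorem LinearMap.eq_zero_of_sup_eq_top {V U : Type*} [AddCommGroup V] [Module K V]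
    [AddCommGroup U] [Module K U] {f : V →ₗ[K] U} {D F : Submodule K V} (h : D ⊔ F = ⊤)
    (hD : D ≤ LinearMap.ker f) (hF : F ≤ LinearMap.ker f) : f = 0 :=
  LinearMap.ker_eq_top.mp (top_le_iff.mp (h ▸ sup_le hD hF))

/-- An element of the centroid whose image is centralized by a subalgebra `H` vanishes on
`[H, H]`. -/
theorem derivedSeries_one_le_ker_of_centralizes {θ : G →ₗ[K] G} (hθ : θ ∈ centroid K G)
    (H : LieSubalgebra K G) (hH : ∀ h ∈ H, ∀ y, ⁅h, θ y⁆ = 0) :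
    (LieAlgebra.derivedSeries K H 1).toSubmodule ≤
      LinearMap.ker (θ ∘ₗ H.toSubmodule.subtype) := by
  change (⁅(⊤ : LieIdeal K H), (⊤ : LieIdeal K H)⁆ : LieIdeal K H).toSubmodule ≤ _
  rw [LieSubmodule.lieIdeal_oper_eq_linear_span', Submodule.span_le]
  rintro _ ⟨a, -, b, -, rfl⟩
  change θ ⁅(a : G), (b : G)⁆ = 0
  rw [centroid_apply_lie hθ, hH a a.2]

end

/-- The centroid of a weakly Noetherian Lie algebra is finite
dimensional. -/
theorem weaklyNoetherian_centroid_finiteDimensional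
    (K G : Type*) [Field K] [CharZero K] [LieRing G] [LieAlgebra K G]
    (hG : WeaklyNoetherian K G) :
    FiniteDimensional K (centroid K G) := by
  obtain ⟨S, hcomm, hmax⟩ := exists_maximal_commuting_set G
  have hspan : FiniteDimensional K (Submodule.span K S) :=
    hG.finiteDimensional_of_lie_eq_zero _ (lie_eq_zero_of_mem_span hcomm)
  let W := centroidAnnihilatorImage K S
  have hW : FiniteDimensional K W :=
    Submodule.finiteDimensional_of_le (centroidAnnihilatorImage_le_span hmax)
  let ρ : G →ₗ[K] Module.End K W := LieModule.toEnd K G W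
  let H : LieSubalgebra K G := (LieModule.ker K G W).toLieSubalgebra
  have hmemH : ∀ h ∈ H, ∀ w : W, ⁅h, (w : G)⁆ = 0 := fun h hh w =>
    congrArg Subtype.val ((LieModule.mem_ker K G W _).mp hh w)
  have hquot : FiniteDimensional K (G ⧸ LinearMap.ker ρ) :=
    Module.Finite.equiv ρ.quotKerEquivRange.symm
  obtain ⟨F, hF, hHF⟩ := Submodule.exists_fg_sup_eq_top (LinearMap.ker ρ)
  have hquot' : FiniteDimensional K (H ⧸ (LieAlgebra.derivedSeries K H 1).toSubmodule) := hG H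
  obtain ⟨E, hE, hDE⟩ :=
    Submodule.exists_fg_sup_eq_top (LieAlgebra.derivedSeries K H 1).toSubmodule
  refine hG.finiteDimensional_centroid_of_separating
    (Submodule.span K S ⊔ F ⊔ E.map H.toSubmodule.subtype)
    (((Module.Finite.iff_fg.mp hspan).sup hF).sup (hE.map _)) fun θ hθ hzero => ?_
  have hS : ∀ s ∈ S, θ s = 0 := fun s hs =>
    hzero s (Submodule.mem_sup_left (Submodule.mem_sup_left (Submodule.subset_span hs)))
  have hcent : ∀ h ∈ H, ∀ y, ⁅h, θ y⁆ = 0 := fun h hh y =>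
    hmemH h hh ⟨θ y, apply_mem_centroidAnnihilatorImage hθ hS y⟩
  have hθH : θ ∘ₗ H.toSubmodule.subtype = 0 :=
    LinearMap.eq_zero_of_sup_eq_top hDE (derivedSeries_one_le_ker_of_centralizes hθ H hcent)
      fun x hx => hzero x (Submodule.mem_sup_right (Submodule.mem_map_of_mem hx))
  refine LinearMap.eq_zero_of_sup_eq_top hHF (fun x hx => ?_)
    fun x hx => hzero x (Submodule.mem_sup_left (Submodule.mem_sup_right hx))
  exact LinearMap.congr_fun hθH ⟨x, (LieModule.mem_ker K G W _).mpr (LinearMap.congr_fun hx)⟩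
end

section
/- Let K be a field of characteristic zero, let G be a weakly Noetherian Lie algebra over K, and let d > 1 be an integer. Then the set of maximal Lie ideals m of G such that the quotient G/m is a simple Lie algebra and dim_K(G/m) = d · dim_K(Cent(G/m)) is finite. (Equivalently: G has only finitely many maximal ideals m such that G/m is simple of dimension d over its centroid.) -/
section NestedBracket

variable {L L' : Type*} [LieRing L] [LieRing L'] {d : ℕ}

/-- The iterated bracket `⁅v 0, ⁅v 1, … ⁅v (d - 1), z⁆ … ⁆⁆`. -/
def nestedBracket (v : Fin d → L) (z : L) : L :=
  (List.ofFn v).foldr (fun x y => ⁅x, y⁆) z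

/-- The alternating sum over permutations `σ` of the iterated brackets of the elements
`u i (a (σ i))`, applied to `z`. -/
def altBracket (u : Fin d → L → L) (z : L) (a : Fin d → L) : L :=
  ∑ σ : Equiv.Perm (Fin d), Equiv.Perm.sign σ • nestedBracket (fun i => u i (a (σ i))) z

lemma map_nestedBracket {F : Type*} [FunLike F L L'] (f : F)
    (hf : ∀ x y, f ⁅x, y⁆ = ⁅f x, f y⁆) (v : Fin d → L) (z : L) :
    f (nestedBracket v z) = nestedBracket (fun i => f (v i)) (f z) := by
  have key : ∀ l : List L, f (l.foldr (fun x y => ⁅x, y⁆) z) =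
      (l.map f).foldr (fun x y => ⁅x, y⁆) (f z) := by
    intro l
    induction l with
    | nil => rfl
    | cons x l ih => simp [hf, ih]
  rw [nestedBracket, key, List.map_ofFn]
  rfl

lemma map_altBracket {F : Type*} [FunLike F L L'] [AddMonoidHomClass F L L'] (f : F)
    (hf : ∀ x y, f ⁅x, y⁆ = ⁅f x, f y⁆) {u : Fin d → L → L} {u' : Fin d → L' → L'}
    (hu : ∀ i x, f (u i x) = u' i (f x)) (z : L) (a : Fin d → L) :
    f (altBracket u z a) = altBracket u' (f z) (fun i => f (a i)) := by
  simp only [altBracket, map_sum, Units.smul_def, map_zsmul, map_nestedBracket f hf, hu]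

lemma nestedBracket_eq_zero (v : Fin d → L) (z : L) (i : Fin d) (hi : v i = 0) :
    nestedBracket v z = 0 := by
  have key : ∀ l : List L, 0 ∈ l → l.foldr (fun x y => ⁅x, y⁆) z = 0 := by
    intro l hl
    induction l with
    | nil => simp at hl
    | cons x l ih =>
      rcases List.mem_cons.1 hl with h | h
      · simp [← h]
      · simp [ih h]
  exact key _ (List.mem_ofFn.2 ⟨i, hi⟩)

/-- If no nonzero element is central, some iterated bracket of any length is nonzero. -/
lemma exists_nestedBracket_ne_zero (hL : ∀ y : L, y ≠ 0 → ∃ x : L, ⁅x, y⁆ ≠ 0) {z : L}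
    (hz : z ≠ 0) (d : ℕ) : ∃ v : Fin d → L, nestedBracket v z ≠ 0 := by
  induction d with
  | zero => exact ⟨Fin.elim0, by simpa [nestedBracket] using hz⟩
  | succ d ih =>
    obtain ⟨v, hv⟩ := ih
    obtain ⟨x, hx⟩ := hL _ hv
    exact ⟨Fin.cons x v, by simpa [nestedBracket, List.ofFn_succ] using hx⟩

variable {C : Type*} [Field C] [LieAlgebra C L]

/-- The iterated bracket of the `u i (w i)`, as a multilinear map in `w`. -/
noncomputable def nestedBracketMultilinear (u : Fin d → L →ₗ[C] L) (z : L) :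
    MultilinearMap C (fun _ : Fin d => L) L :=
  (LinearMap.applyₗ z).compMultilinearMap
    ((MultilinearMap.mkPiAlgebraFin C d (Module.End C L)).compLinearMap
      fun i => (LieAlgebra.ad C L : L →ₗ[C] Module.End C L) ∘ₗ u i)

lemma nestedBracketMultilinear_apply (u : Fin d → L →ₗ[C] L) (z : L) (w : Fin d → L) :
    nestedBracketMultilinear u z w = nestedBracket (fun i => u i (w i)) z := by
  have key : ∀ l : List L, (l.map (LieAlgebra.ad C L)).prod z =
      l.foldr (fun x y => ⁅x, y⁆) z := by
    intro l
    induction l with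
    | nil => rfl
    | cons x l ih => simp [ih]
  rw [nestedBracket, ← key, List.map_ofFn]
  simp only [nestedBracketMultilinear, LinearMap.compMultilinearMap_apply,
    MultilinearMap.compLinearMap_apply, MultilinearMap.mkPiAlgebraFin_apply]
  rfl

/-- In dimension `d`, the alternating sum of iterated brackets is a determinant times a fixed
vector. -/
lemma altBracket_eq_det_smul (b : Module.Basis (Fin d) C L) (u : Fin d → L →ₗ[C] L) (z : L)
    (a : Fin d → L) :
    altBracket (fun i => u i) z a = b.det a • altBracket (fun i => u i) z b := by
  have halt : ∀ w : Fin d → L, (nestedBracketMultilinear u z).alternatization w =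
      altBracket (fun i => u i) z w := by
    intro w
    simp only [MultilinearMap.alternatization_apply, altBracket,
      MultilinearMap.domDomCongr_apply, nestedBracketMultilinear_apply]
  set f := (nestedBracketMultilinear u z).alternatization with hf
  have h : f = (LinearMap.toSpanSingleton C L (f b)).compAlternatingMap b.det := by
    refine b.ext_alternating fun v hv => ?_
    let σ : Equiv.Perm (Fin d) := Equiv.ofBijective v (Finite.injective_iff_bijective.1 hv)
    have h1 : (fun i => b (v i)) = b ∘ σ := rfl
    rw [h1]
    simp [AlternatingMap.map_perm, Module.Basis.det_self, Units.smul_def]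
  rw [← halt, ← halt, h]
  simp [Module.Basis.det_self]

/-- If `u i` is the endomorphism sending the `i`-th basis vector to `v i` and the others to `0`,
then only the identity permutation contributes to the alternating sum. -/
lemma altBracket_constr_single (b : Module.Basis (Fin d) C L) (v : Fin d → L) (z : L) :
    altBracket (fun i => b.constr ℕ (Pi.single i (v i) : Fin d → L)) z b = nestedBracket v z := by
  rw [altBracket, Finset.sum_eq_single 1]
  · simp
  · intro σ _ hσ
    obtain ⟨i, hi⟩ : ∃ i, σ i ≠ i := by
      by_contra! h
      exact hσ (Equiv.ext h)
    rw [nestedBracket_eq_zero _ _ i (by simp [hi]), smul_zero]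
  · simp

end NestedBracket

section Simple

variable (K L : Type*) [Field K] [LieRing L] [LieAlgebra K L]

/-- The associative algebra of endomorphisms generated by the inner derivations. -/
abbrev adAlgebra : Subalgebra K (Module.End K L) :=
  Algebra.adjoin K (Set.range (LieAlgebra.ad K L))

variable {K L}

lemma ad_mem_adAlgebra (x : L) : LieAlgebra.ad K L x ∈ adAlgebra K L :=
  Algebra.subset_adjoin ⟨x, rfl⟩

lemma exists_lie_ne_zero [LieAlgebra.IsSimple K L] {y : L} (hy : y ≠ 0) : ∃ x : L, ⁅x, y⁆ ≠ 0 := by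
  by_contra! h
  have hc : y ∈ LieAlgebra.center K L := by
    rw [LieModule.mem_maxTrivSubmodule]
    exact h
  rcases LieAlgebra.IsSimple.eq_bot_or_eq_top (LieAlgebra.center K L) with h0 | h1
  · rw [h0] at hc
    exact hy (by simpa using hc)
  · exact LieAlgebra.IsSimple.non_abelian K
      ((LieAlgebra.isLieAbelian_iff_center_eq_top K L).2 h1)

lemma nontrivial_of_isSimple [LieAlgebra.IsSimple K L] : Nontrivial L := by
  by_contra h
  rw [not_nontrivial_iff_subsingleton] at h
  exact LieAlgebra.IsSimple.non_abelian (R := K) (L := L) ⟨fun x y => Subsingleton.elim _ _⟩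

instance isSimpleModule_adAlgebra [LieAlgebra.IsSimple K L] :
    IsSimpleModule (adAlgebra K L) L := by
  have : Nontrivial L := nontrivial_of_isSimple (K := K)
  refine (isSimpleModule_iff (adAlgebra K L) L).2 (IsSimpleOrder.of_forall_eq_top fun N hN => ?_)
  let I : LieIdeal K L :=
    { N.restrictScalars K with
      lie_mem := fun {x y} hy => N.smul_mem ⟨_, ad_mem_adAlgebra x⟩ hy }
  have hI : ∀ x, x ∈ I ↔ x ∈ N := fun x => Iff.rfl
  rcases LieAlgebra.IsSimple.eq_bot_or_eq_top I with h | h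
  · refine absurd ((Submodule.eq_bot_iff N).2 fun x hx => ?_) hN
    rw [← hI, h] at hx
    simpa using hx
  · refine (Submodule.eq_top_iff'.2 fun x => ?_)
    rw [← hI, h]
    trivial

/-- The endomorphisms commuting with the inner derivations. -/
abbrev Commutant (K L : Type*) [Field K] [LieRing L] [LieAlgebra K L] : Type _ :=
  Module.End (adAlgebra K L) L

lemma commutant_apply_lie (θ : Commutant K L) (x y : L) : θ ⁅x, y⁆ = ⁅x, θ y⁆ :=
  θ.map_smul ⟨_, ad_mem_adAlgebra x⟩ y

lemma commutant_apply_lie_left (θ : Commutant K L) (x y : L) : θ ⁅x, y⁆ = ⁅θ x, y⁆ := by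
  rw [← lie_skew, map_neg, commutant_apply_lie, lie_skew]

lemma commutant_mul_comm [LieAlgebra.IsSimple K L] (θ φ : Commutant K L) : θ * φ = φ * θ := by
  rw [← sub_eq_zero]
  ext y
  by_contra h
  obtain ⟨x, hx⟩ := exists_lie_ne_zero (K := K) h
  apply hx
  simp only [LinearMap.sub_apply, Module.End.mul_apply, lie_sub]
  rw [← commutant_apply_lie, commutant_apply_lie_left, ← commutant_apply_lie,
    ← commutant_apply_lie, ← commutant_apply_lie_left, ← commutant_apply_lie, sub_self]

noncomputable instance [LieAlgebra.IsSimple K L] : Field (Commutant K L) :=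
  letI := Classical.decEq (Commutant K L)
  { (inferInstance : DivisionRing (Commutant K L)) with
    mul_comm := commutant_mul_comm }

instance [LieAlgebra.IsSimple K L] : LieAlgebra (Commutant K L) L where
  lie_smul θ x y := (commutant_apply_lie θ x y).symm


/-- The centroid is the commutant of the inner derivations. -/
noncomputable def commutantEquivCentroid : Commutant K L ≃ₗ[K] centroid K L where
  toFun θ := ⟨θ.restrictScalars K, commutant_apply_lie θ⟩
  map_add' _ _ := rfl
  map_smul' _ _ := rfl
  invFun θ :=
    { θ.1 with
      map_smul' := by
        rintro ⟨r, hr⟩ x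
        change θ.1 (r x) = r (θ.1 x)
        induction hr using Algebra.adjoin_induction generalizing x with
        | mem r hr =>
          obtain ⟨y, rfl⟩ := hr
          exact θ.2 y x
        | algebraMap c => simp
        | add r s _ _ hr hs => simp [hr, hs]
        | mul r s _ _ hr hs => simp [hr, hs] }
  left_inv _ := rfl
  right_inv _ := rfl

lemma rank_commutant [LieAlgebra.IsSimple K L] [FiniteDimensional K (centroid K L)] {d : ℕ}
    (hd : Module.rank K L = d * Module.rank K (centroid K L)) :
    Module.rank (Commutant K L) L = d := by
  have := Module.Finite.equiv (commutantEquivCentroid (K := K) (L := L)).symm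
  rw [← (commutantEquivCentroid (K := K) (L := L)).rank_eq,
    ← rank_mul_rank K (Commutant K L) L, mul_comm] at hd
  have h0 : Module.rank K (Commutant K L) ≠ 0 := rank_pos.ne'
  rw [← Module.finrank_eq_rank K (Commutant K L)] at hd h0
  have hlt : Module.rank (Commutant K L) L < Cardinal.aleph0 := by
    have h := (Cardinal.mul_lt_aleph0_iff (a := Module.rank (Commutant K L) L)
      (b := Module.finrank K (Commutant K L))).1 (by
        rw [hd]; exact_mod_cast Cardinal.natCast_lt_aleph0)
    rcases h with h | h | h
    · rw [h]; exact Cardinal.aleph0_pos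
    · exact absurd h h0
    · exact h.1
  lift Module.rank (Commutant K L) L to ℕ using hlt with n
  norm_cast at hd h0 ⊢
  exact Nat.eq_of_mul_eq_mul_right (Nat.pos_of_ne_zero h0) hd

/-- The values of `altBracket u z` lie on a line over the centroid. -/
lemma exists_altBracket_eq_centroid_apply [LieAlgebra.IsSimple K L]
    [FiniteDimensional K (centroid K L)] {d : ℕ}
    (hd : Module.rank K L = d * Module.rank K (centroid K L))
    (u : Fin d → adAlgebra K L) (z : L) :
    ∃ v : L, ∀ a, ∃ θ ∈ centroid K L, altBracket (fun i => (u i : Module.End K L)) z a = θ v := by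
  have hr := rank_commutant hd
  have : Module.Finite (Commutant K L) L :=
    Module.rank_lt_aleph0_iff.1 (hr ▸ Cardinal.natCast_lt_aleph0)
  let b := Module.finBasisOfFinrankEq (Commutant K L) L (Module.finrank_eq_of_rank_eq hr)
  let u' : Fin d → L →ₗ[Commutant K L] L := fun i =>
    { toFun := fun x => (u i : Module.End K L) x
      map_add' := map_add _
      map_smul' := fun θ x => (θ.map_smul (u i) x).symm }
  exact ⟨_, fun a => ⟨_, (commutantEquivCentroid (b.det a)).2, altBracket_eq_det_smul b u' z a⟩⟩

lemma exists_altBracket_ne_zero [LieAlgebra.IsSimple K L]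
    [FiniteDimensional K (centroid K L)] {d : ℕ}
    (hd : Module.rank K L = d * Module.rank K (centroid K L)) :
    ∃ (u : Fin d → adAlgebra K L) (z : L) (a : Fin d → L),
      altBracket (fun i => (u i : Module.End K L)) z a ≠ 0 := by
  have hr := rank_commutant hd
  have : Module.Finite (Commutant K L) L :=
    Module.rank_lt_aleph0_iff.1 (hr ▸ Cardinal.natCast_lt_aleph0)
  let b := Module.finBasisOfFinrankEq (Commutant K L) L (Module.finrank_eq_of_rank_eq hr)
  have : Nontrivial L := nontrivial_of_isSimple (K := K)
  obtain ⟨z, hz⟩ := exists_ne (0 : L)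
  obtain ⟨v, hv⟩ := exists_nestedBracket_ne_zero
    (fun y hy => exists_lie_ne_zero (K := K) (y := y) hy) hz d
  classical
  choose u hu using fun i => jacobson_density (R := adAlgebra K L)
    (b.constr ℕ (Pi.single i (v i) : Fin d → L)) (Finset.univ.image b)
  refine ⟨u, z, b, ?_⟩
  rw [← altBracket_constr_single b v z] at hv
  convert! hv using 1
  simp only [altBracket]
  refine Finset.sum_congr rfl fun σ _ => ?_
  congr 2
  ext i
  exact (hu i _ (Finset.mem_image_of_mem _ (Finset.mem_univ _))).symm

lemma altBracket_zero {d : ℕ} (hd : 0 < d) (u : Fin d → Module.End K L) (z : L) :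
    altBracket (fun i => u i) z 0 = 0 :=
  Finset.sum_eq_zero fun σ _ => by
    rw [nestedBracket_eq_zero _ _ ⟨0, hd⟩ (by simp), smul_zero]

end Simple

section Ideals

open LieSubmodule.Quotient (mk')

variable {K G : Type*} [Field K] [LieRing G] [LieAlgebra K G]

lemma mk'_lie (m : LieIdeal K G) (x y : G) : mk' m ⁅x, y⁆ = ⁅mk' m x, mk' m y⁆ := rfl

lemma centroid_lie_apply_self {θ φ : G →ₗ[K] G} (hθ : θ ∈ centroid K G) (hφ : φ ∈ centroid K G)
    (x : G) : ⁅θ x, φ x⁆ = 0 := by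
  rw [← hφ, ← lie_skew, ← hθ, lie_self, map_zero, neg_zero, map_zero]

lemma exists_adAlgebra_quotient (m : LieIdeal K G) (T : adAlgebra K G) :
    ∃ T' : adAlgebra K (G ⧸ m), ∀ x, mk' m (T.1 x) = T'.1 (mk' m x) := by
  obtain ⟨T, hT⟩ := T
  induction hT using Algebra.adjoin_induction with
  | mem r hr =>
    obtain ⟨y, rfl⟩ := hr
    exact ⟨⟨_, ad_mem_adAlgebra (mk' m y)⟩, fun x => mk'_lie m y x⟩
  | algebraMap c => exact ⟨algebraMap _ _ c, fun x => by simp [Algebra.algebraMap_eq_smul_one]⟩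
  | add r s _ _ hr hs =>
    obtain ⟨r', hr⟩ := hr
    obtain ⟨s', hs⟩ := hs
    exact ⟨r' + s', fun x => by simpa using congrArg₂ (· + ·) (hr x) (hs x)⟩
  | mul r s _ _ hr hs =>
    obtain ⟨r', hr⟩ := hr
    obtain ⟨s', hs⟩ := hs
    exact ⟨r' * s', fun x => (hr (s x)).trans (congrArg r'.1 (hs x))⟩

lemma exists_adAlgebra_lift (m : LieIdeal K G) (T' : adAlgebra K (G ⧸ m)) :
    ∃ T : adAlgebra K G, ∀ x, mk' m (T.1 x) = T'.1 (mk' m x) := by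
  obtain ⟨T', hT'⟩ := T'
  induction hT' using Algebra.adjoin_induction with
  | mem r hr =>
    obtain ⟨y, rfl⟩ := hr
    obtain ⟨y, rfl⟩ := LieSubmodule.Quotient.surjective_mk' m y
    exact ⟨⟨_, ad_mem_adAlgebra y⟩, fun x => mk'_lie m y x⟩
  | algebraMap c => exact ⟨algebraMap _ _ c, fun x => by simp [Algebra.algebraMap_eq_smul_one]⟩
  | add r s _ _ hr hs =>
    obtain ⟨r', hr⟩ := hr
    obtain ⟨s', hs⟩ := hs
    exact ⟨r' + s', fun x => by simpa using congrArg₂ (· + ·) (hr x) (hs x)⟩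
  | mul r s _ _ hr hs =>
    obtain ⟨r', hr⟩ := hr
    obtain ⟨s', hs⟩ := hs
    exact ⟨r' * s', fun x => (hr (s'.1 x)).trans (congrArg r (hs x))⟩

lemma inf_sup_eq_top {m I J : LieIdeal K G} (hm : IsCoatom m) (hs : LieAlgebra.IsSimple K (G ⧸ m))
    (hI : I ⊔ m = ⊤) (hJ : J ⊔ m = ⊤) : (I ⊓ J) ⊔ m = ⊤ := by
  by_contra h
  have hle : I ⊓ J ≤ m := by
    by_contra hle
    exact h (hm.2 _ (right_lt_sup.2 hle))
  refine hs.non_abelian ⟨fun x y => ?_⟩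
  obtain ⟨x, rfl⟩ := LieSubmodule.Quotient.surjective_mk' m x
  obtain ⟨y, rfl⟩ := LieSubmodule.Quotient.surjective_mk' m y
  obtain ⟨i, hi, a, ha, rfl⟩ := (LieSubmodule.mem_sup I m x).1 (hI ▸ LieSubmodule.mem_top x)
  obtain ⟨j, hj, b, hb, rfl⟩ := (LieSubmodule.mem_sup J m y).1 (hJ ▸ LieSubmodule.mem_top y)
  change ⁅mk' m (i + a), mk' m (j + b)⁆ = 0
  have ha' := (LieSubmodule.Quotient.mk_eq_zero m).2 ha
  have hb' := (LieSubmodule.Quotient.mk_eq_zero m).2 hb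
  rw [map_add, map_add, ha', hb', add_zero, add_zero]
  rw [← mk'_lie, LieSubmodule.Quotient.mk_eq_zero]
  refine hle ⟨?_, ?_⟩
  · exact lie_mem_left K G I i j hi
  · exact lie_mem_right K G J i j hj

/-- Every element is congruent modulo `m` to one lying in finitely many other maximal ideals. -/
lemma exists_mem_forall_sub_mem {m : LieIdeal K G} (hm : IsCoatom m)
    (hs : LieAlgebra.IsSimple K (G ⧸ m)) (F : Finset (LieIdeal K G))
    (hF : ∀ m' ∈ F, IsCoatom m' ∧ m' ≠ m) (x : G) :
    ∃ y, (∀ m' ∈ F, y ∈ m') ∧ mk' m y = mk' m x := by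
  classical
  have key : F.inf id ⊔ m = ⊤ := by
    induction F using Finset.induction_on with
    | empty => simp
    | insert m' F _ ih =>
      rw [Finset.inf_insert]
      have hm' := hF m' (Finset.mem_insert_self _ _)
      exact inf_sup_eq_top hm hs (hm'.1.sup_eq_top_of_ne hm hm'.2)
        (ih fun n hn => hF n (Finset.mem_insert_of_mem hn))
  obtain ⟨y, hy, a, ha, rfl⟩ := (LieSubmodule.mem_sup _ m x).1 (key ▸ LieSubmodule.mem_top x)
  refine ⟨y, fun m' hm' => (Finset.inf_le hm' : F.inf id ≤ m') hy, ?_⟩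
  rw [map_add, (LieSubmodule.Quotient.mk_eq_zero m).2 ha, add_zero]

/-- The elements whose image modulo each `m ∈ S` is a centroid multiple of `v m`. -/
def centroidLines (S : Set (LieIdeal K G)) (v : ∀ m : LieIdeal K G, G ⧸ m) :
    LieSubalgebra K G where
  carrier := {y | ∀ m ∈ S, ∃ θ ∈ centroid K (G ⧸ m), mk' m y = θ (v m)}
  add_mem' {x y} hx hy m hm := by
    obtain ⟨θ, hθ, hx⟩ := hx m hm
    obtain ⟨φ, hφ, hy⟩ := hy m hm
    exact ⟨θ + φ, add_mem hθ hφ, by rw [map_add, hx, hy, LinearMap.add_apply]⟩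
  zero_mem' m _ := ⟨0, zero_mem _, by simp⟩
  smul_mem' c x hx m hm := by
    obtain ⟨θ, hθ, hx⟩ := hx m hm
    exact ⟨c • θ, Submodule.smul_mem _ c hθ, by rw [map_smul, hx, LinearMap.smul_apply]⟩
  lie_mem' {x y} hx hy m hm := by
    obtain ⟨θ, hθ, hx⟩ := hx m hm
    obtain ⟨φ, hφ, hy⟩ := hy m hm
    exact ⟨0, zero_mem _, by
      rw [mk'_lie, hx, hy, centroid_lie_apply_self hθ hφ, LinearMap.zero_apply]⟩

lemma mk'_lie_eq_zero_of_mem_centroidLines {S : Set (LieIdeal K G)}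
    {v : ∀ m : LieIdeal K G, G ⧸ m} {x y : G} (hx : x ∈ centroidLines S v)
    (hy : y ∈ centroidLines S v) {m : LieIdeal K G} (hm : m ∈ S) : mk' m ⁅x, y⁆ = 0 := by
  obtain ⟨θ, hθ, hx⟩ := hx m hm
  obtain ⟨φ, hφ, hy⟩ := hy m hm
  rw [mk'_lie, hx, hy, centroid_lie_apply_self hθ hφ]

/-- A linear map on a weakly Noetherian Lie algebra has finite-dimensional image on every
subalgebra whose brackets it kills. -/
lemma WeaklyNoetherian.finiteDimensional_map (hG : WeaklyNoetherian K G) (h : LieSubalgebra K G)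
    {V : Type*} [AddCommGroup V] [Module K V] (f : G →ₗ[K] V)
    (hf : ∀ x ∈ h, ∀ y ∈ h, f ⁅x, y⁆ = 0) : FiniteDimensional K (h.toSubmodule.map f) := by
  have := hG h
  let D : Submodule K h := (LieAlgebra.derivedSeries K h 1).toSubmodule
  have hD : D ≤ LinearMap.ker (f ∘ₗ h.toSubmodule.subtype) := by
    simp only [D, LieAlgebra.derivedSeriesOfIdeal_succ,
      LieAlgebra.derivedSeriesOfIdeal_zero, LieSubmodule.lieIdeal_oper_eq_linear_span']
    rw [Submodule.span_le]
    rintro _ ⟨x, -, y, -, rfl⟩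
    exact hf x x.2 y y.2
  have hfin : FiniteDimensional K (h ⧸ D) := this
  have hr : LinearMap.range (D.liftQ _ hD) = h.toSubmodule.map f := by
    rw [Submodule.range_liftQ, LinearMap.range_comp, Submodule.range_subtype]
  rw [← hr]
  infer_instance

lemma WeaklyNoetherian.finiteDimensional_centroid (hG : WeaklyNoetherian K G) (m : LieIdeal K G)
    (hs : LieAlgebra.IsSimple K (G ⧸ m)) : FiniteDimensional K (centroid K (G ⧸ m)) := by
  have : Nontrivial (G ⧸ m) := nontrivial_of_isSimple (K := K)
  obtain ⟨z, hz⟩ := exists_ne (0 : G ⧸ m)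
  obtain ⟨z, rfl⟩ := LieSubmodule.Quotient.surjective_mk' m z
  let v : ∀ m : LieIdeal K G, G ⧸ m := fun m => mk' m z
  have hfin := hG.finiteDimensional_map (centroidLines {m} v) (mk' m : G →ₗ[K] G ⧸ m)
    fun x hx y hy => mk'_lie_eq_zero_of_mem_centroidLines hx hy rfl
  let e : Commutant K (G ⧸ m) →ₗ[K] G ⧸ m :=
    { toFun := fun θ => θ (mk' m z), map_add' := fun _ _ => rfl, map_smul' := fun _ _ => rfl }
  have he : Function.Injective e := by
    rw [injective_iff_map_eq_zero]
    intro θ hθ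
    exact (smul_eq_zero.1 (show θ • mk' m z = 0 from hθ)).resolve_right hz
  have hle : ∀ θ, e θ ∈ (centroidLines {m} v).toSubmodule.map (mk' m : G →ₗ[K] G ⧸ m) := by
    intro θ
    obtain ⟨y, hy⟩ := LieSubmodule.Quotient.surjective_mk' m (e θ)
    refine ⟨y, ?_, hy⟩
    rintro _ rfl
    exact ⟨_, (commutantEquivCentroid θ).2, hy⟩
  have := Module.Finite.of_injective (e.codRestrict _ hle)
    (fun a b hab => he (congrArg Subtype.val hab))
  exact Module.Finite.equiv (commutantEquivCentroid (K := K) (L := G ⧸ m))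

/-- Finitely many ideals of `S` already separate `centroidLines S v` modulo the intersection
of `S`. -/
lemma WeaklyNoetherian.exists_finset_centroidLines (hG : WeaklyNoetherian K G)
    (S : Set (LieIdeal K G)) (v : ∀ m : LieIdeal K G, G ⧸ m) :
    ∃ F : Finset S, ∀ y ∈ centroidLines S v,
      (∀ m ∈ F, mk' m.1 y = 0) → ∀ m ∈ S, mk' m y = 0 := by
  classical
  let f : G →ₗ[K] (∀ m : S, G ⧸ m.1) := LinearMap.pi fun m => (mk' m.1 : G →ₗ[K] G ⧸ m.1)
  have hfin := hG.finiteDimensional_map (centroidLines S v) f fun x hx y hy =>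
    funext fun m => mk'_lie_eq_zero_of_mem_centroidLines hx hy m.2
  set W := (centroidLines S v).toSubmodule.map f
  let N : Finset S → Submodule K W := fun F =>
    ⨅ m ∈ F, LinearMap.ker (LinearMap.proj m ∘ₗ W.subtype)
  obtain ⟨_, ⟨F, rfl⟩, hF⟩ := IsArtinian.set_has_minimal (Set.range N) (Set.range_nonempty N)
  refine ⟨F, fun y hy h0 m hm => ?_⟩
  have hle : N (insert ⟨m, hm⟩ F) ≤ N F :=
    biInf_mono fun i hi => Finset.mem_insert_of_mem hi
  have heq : N (insert ⟨m, hm⟩ F) = N F := by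
    by_contra hne
    exact hF _ ⟨_, rfl⟩ (lt_of_le_of_ne hle hne)
  have hyN : (⟨f y, y, hy, rfl⟩ : W) ∈ N F := by
    simp only [N, Submodule.mem_iInf]
    exact fun m hm => h0 m hm
  rw [← heq] at hyN
  simp only [N, Submodule.mem_iInf] at hyN
  exact hyN ⟨m, hm⟩ (Finset.mem_insert_self _ _)

end Ideals

section Finiteness

open LieSubmodule.Quotient (mk' mk_eq_zero)

variable {K G : Type*} [Field K] [LieRing G] [LieAlgebra K G] {d : ℕ} {S : Set (LieIdeal K G)}

/-- For fixed `u` and `z`, the values `altBracket u z a` are nonzero modulo only finitely many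
of the ideals considered. -/
lemma finite_setOf_altBracket_notMem (hG : WeaklyNoetherian K G) (hd : 0 < d)
    (hS : ∀ m ∈ S, IsCoatom m ∧ LieAlgebra.IsSimple K (G ⧸ m) ∧
      Module.rank K (G ⧸ m) = d * Module.rank K (centroid K (G ⧸ m)))
    (u : Fin d → adAlgebra K G) (z : G) :
    {m ∈ S | ∃ a, altBracket (fun i => (u i : Module.End K G)) z a ∉ m}.Finite := by
  by_contra hinf
  replace hinf : Set.Infinite _ := hinf
  choose u' hu' using fun (m : LieIdeal K G) i => exists_adAlgebra_quotient m (u i)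
  have hmap : ∀ m a, mk' m (altBracket (fun i => (u i : Module.End K G)) z a) =
      altBracket (fun i => (u' m i : Module.End K (G ⧸ m))) (mk' m z) (fun i => mk' m (a i)) :=
    fun m a => map_altBracket (mk' m) (mk'_lie m) (hu' m) z a
  have hv : ∀ m : LieIdeal K G, ∃ v : G ⧸ m, m ∈ S → ∀ a, ∃ θ ∈ centroid K (G ⧸ m),
      altBracket (fun i => (u' m i : Module.End K (G ⧸ m))) (mk' m z) a = θ v := by
    intro m
    by_cases hm : m ∈ S
    · obtain ⟨-, hs, hr⟩ := hS m hm
      have := hG.finiteDimensional_centroid m hs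
      obtain ⟨v, hv⟩ := exists_altBracket_eq_centroid_apply hr (u' m) (mk' m z)
      exact ⟨v, fun _ => hv⟩
    · exact ⟨0, fun h => absurd h hm⟩
  choose v hv using hv
  obtain ⟨F, hF⟩ := hG.exists_finset_centroidLines S v
  obtain ⟨m, ⟨hm, a, ha⟩, hmF⟩ :=
    hinf.exists_notMem_finset (F.map (Function.Embedding.subtype _))
  obtain ⟨hco, hs, hr⟩ := hS m hm
  choose a' ha'F ha'm using fun i => exists_mem_forall_sub_mem hco hs
    (F.map (Function.Embedding.subtype _)) (fun n hn => by
      refine ⟨?_, fun h => hmF (h ▸ hn)⟩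
      obtain ⟨n, -, rfl⟩ := Finset.mem_map.1 hn
      exact (hS n n.2).1) (a i)
  apply ha
  rw [← mk_eq_zero, hmap, ← funext ha'm, ← hmap]
  refine hF _ (fun n hn => ?_) (fun n hn => ?_) m hm
  · rw [hmap]
    exact hv n hn _
  · have h0 : (fun i => mk' n.1 (a' i)) = 0 :=
      funext fun i => (mk_eq_zero n.1).2 (ha'F i n.1 (Finset.mem_map_of_mem _ hn))
    rw [hmap, h0]
    exact altBracket_zero hd (fun i => (u' n.1 i).1) _

/-- A set of ideals of a weakly Noetherian Lie algebra is finite if each member `m` misses an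
element that lies in all the others. -/
lemma finite_of_forall_exists_separated (hG : WeaklyNoetherian K G)
    (hsep : ∀ m ∈ S, ∃ y ∉ m, ∀ n ∈ S, n ≠ m → y ∈ n) : S.Finite := by
  by_contra hinf
  replace hinf : S.Infinite := hinf
  choose! y hym hyn using hsep
  obtain ⟨F, hF⟩ := hG.exists_finset_centroidLines S fun m => mk' m (y m)
  obtain ⟨m, hm, hmF⟩ := hinf.exists_notMem_finset (F.map (Function.Embedding.subtype _))
  refine hym m hm ((mk_eq_zero m).1 (hF (y m) (fun n hn => ?_) (fun n hn => ?_) m hm))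
  · by_cases hnm : n = m
    · subst hnm
      exact ⟨LinearMap.id, fun _ _ => rfl, rfl⟩
    · exact ⟨0, zero_mem _, (mk_eq_zero n).2 (hyn m hm n hn hnm)⟩
  · exact (mk_eq_zero n.1).2 (hyn m hm n n.2 fun h => hmF (h ▸ Finset.mem_map_of_mem _ hn))

lemma exists_separated (hG : WeaklyNoetherian K G) (hd : 0 < d)
    (hS : ∀ m ∈ S, IsCoatom m ∧ LieAlgebra.IsSimple K (G ⧸ m) ∧
      Module.rank K (G ⧸ m) = d * Module.rank K (centroid K (G ⧸ m)))
    {m : LieIdeal K G} (hm : m ∈ S) : ∃ y ∉ m, ∀ n ∈ S, n ≠ m → y ∈ n := by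
  classical
  obtain ⟨hco, hs, hr⟩ := hS m hm
  have := hG.finiteDimensional_centroid m hs
  obtain ⟨u', z', a', hne⟩ := exists_altBracket_ne_zero hr
  choose u hu using fun i => exists_adAlgebra_lift m (u' i)
  obtain ⟨z, rfl⟩ := LieSubmodule.Quotient.surjective_mk' m z'
  choose a ha using fun i => LieSubmodule.Quotient.surjective_mk' m (a' i)
  obtain rfl := funext ha
  rw [← map_altBracket (mk' m) (mk'_lie m) hu] at hne
  have hfin := finite_setOf_altBracket_notMem hG hd hS u z
  set y := altBracket (fun i => (u i : Module.End K G)) z a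
  obtain ⟨x, hx⟩ := exists_lie_ne_zero (K := K) hne
  obtain ⟨x, rfl⟩ := LieSubmodule.Quotient.surjective_mk' m x
  obtain ⟨w, hwF, hwm⟩ := exists_mem_forall_sub_mem hco hs (hfin.toFinset.erase m) (fun n hn => by
    rw [Finset.mem_erase, Set.Finite.mem_toFinset] at hn
    exact ⟨(hS n hn.2.1).1, hn.1⟩) x
  refine ⟨⁅w, y⁆, fun h => ?_, fun n hn hnm => ?_⟩
  · rw [← mk_eq_zero, mk'_lie, hwm] at h
    exact hx h
  · by_cases hyn : y ∈ n
    · exact lie_mem_right K G n w y hyn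
    · exact lie_mem_left K G n w y (hwF n (Finset.mem_erase.2
        ⟨hnm, hfin.mem_toFinset.2 ⟨hn, a, hyn⟩⟩))

end Finiteness

/-- A weakly Noetherian Lie algebra has only finitely many maximal Lie
ideals `m` such that `G/m` is a simple Lie algebra of dimension `d` over its centroid,
i.e. `dim_K (G/m) = d · dim_K Cent(G/m)`. -/
theorem weaklyNoetherian_finitely_many_maximal_ideals_of_fixed_codim
    (K G : Type*) [Field K] [CharZero K] [LieRing G] [LieAlgebra K G]
    (hG : WeaklyNoetherian K G) (d : ℕ) (hd : 1 < d) :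
    {m : LieIdeal K G | IsCoatom m ∧ LieAlgebra.IsSimple K (G ⧸ m) ∧
      Module.rank K (G ⧸ m) = d * Module.rank K (centroid K (G ⧸ m))}.Finite := by
  exact finite_of_forall_exists_separated hG fun m hm =>
    exists_separated hG (zero_lt_one.trans hd) (fun n hn => hn) hm
end

section
/- Let K be a field of characteristic zero, let m ≥ 1, and let P be a nonzero element of the free Lie algebra over K on m generators. Let (s_i)_{i∈ℕ} be a family of finite-dimensional simple Lie algebras over K such that dim_K(s_i)/dim_K(Cent(s_i)) tends to infinity, i.e. for every C there is N with dim_K(s_i) > C · dim_K(Cent(s_i)) for all i ≥ N. Then for all sufficiently large i the Lie algebra s_i does not satisfy the identity P: there exists a Lie algebra homomorphism f from the free Lie algebra on m generators to s_i with f(P) ≠ 0. -/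
attribute [local instance] LieRing.ofAssociativeRing

namespace FreeLieAlgebra

/-- An induction principle for the free Lie algebra. -/
theorem span_induction {R X : Type*} [CommRing R] {p : FreeLieAlgebra R X → Prop}
    (of : ∀ x, p (of R x)) (zero : p 0) (add : ∀ a b, p a → p b → p (a + b))
    (smul : ∀ (c : R) a, p a → p (c • a)) (lie : ∀ a b, p a → p b → p ⁅a, b⁆)
    (a : FreeLieAlgebra R X) : p a := by
  let S : LieSubalgebra R (FreeLieAlgebra R X) :=
    { carrier := {a | p a}
      add_mem' := fun ha hb => add _ _ ha hb
      zero_mem' := zero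
      smul_mem' := fun c a ha => smul c a ha
      lie_mem' := fun ha hb => lie _ _ ha hb }
  let F : FreeLieAlgebra R X →ₗ⁅R⁆ S := FreeLieAlgebra.lift R fun x => ⟨FreeLieAlgebra.of R x, of x⟩
  have h : S.incl.comp F = LieHom.id := by
    ext x
    simp [F]
  have := (F a).2
  have h2 := LieHom.congr_fun h a
  simp only [LieHom.comp_apply, LieHom.id_apply] at h2
  rw [← h2]
  exact this

variable (R X : Type*) [CommRing R]

/-- The canonical morphism from the free Lie algebra to the free associative algebra. -/
noncomputable def toFreeAlgebra : FreeLieAlgebra R X →ₗ⁅R⁆ FreeAlgebra R X :=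
  FreeLieAlgebra.lift R (FreeAlgebra.ι R)

/-- The right-normed bracketing `x₁ ⋯ xₙ ↦ ⁅x₁, ⁅x₂, …, xₙ⁆⁆`, sending the empty word to zero,
paired with the augmentation. -/
noncomputable def bracketingRep :
    FreeAlgebra R X →ₐ[R] Module.End R (FreeLieAlgebra R X × R) :=
  FreeAlgebra.lift R fun x =>
    ((LieAlgebra.ad R _ (of R x)).comp (LinearMap.fst R _ _) +
      (LinearMap.toSpanSingleton R _ (of R x)).comp (LinearMap.snd R _ _)).prod 0

/-- The Dynkin operator on the free Lie algebra. -/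
noncomputable def dynkin : Module.End R (FreeLieAlgebra R X) where
  toFun a := (bracketingRep R X (toFreeAlgebra R X a) (0, 1)).1
  map_add' a b := by simp
  map_smul' c a := by simp

variable {R X}

theorem bracketingRep_toFreeAlgebra (a b : FreeLieAlgebra R X) (c : R) :
    bracketingRep R X (toFreeAlgebra R X a) (b, c) = (⁅a, b⁆ + c • dynkin R X a, 0) := by
  have key : ∀ a : FreeLieAlgebra R X, ∀ b c,
      bracketingRep R X (toFreeAlgebra R X a) (b, c) =
        (⁅a, b⁆ + c • (bracketingRep R X (toFreeAlgebra R X a) (0, 1)).1, 0) := by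
    intro a
    induction a using span_induction with
    | of x => intro b c; simp [toFreeAlgebra, bracketingRep]
    | zero => intro b c; simp; rfl
    | add a₁ a₂ h₁ h₂ =>
      intro b c
      rw [map_add, map_add, LinearMap.add_apply, LinearMap.add_apply, h₁ b, h₂ b]
      ext <;> simp; abel
    | smul r a h =>
      intro b c
      rw [map_smul, map_smul, LinearMap.smul_apply, LinearMap.smul_apply, h b]
      ext <;> simp [smul_comm c r]
    | lie a₁ a₂ h₁ h₂ =>
      intro b c
      have h12 : ∀ y, bracketingRep R X (toFreeAlgebra R X ⁅a₁, a₂⁆) y =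
          bracketingRep R X (toFreeAlgebra R X a₁) (bracketingRep R X (toFreeAlgebra R X a₂) y) -
          bracketingRep R X (toFreeAlgebra R X a₂)
            (bracketingRep R X (toFreeAlgebra R X a₁) y) := by
        intro y
        simp [LieRing.of_associative_ring_bracket]
      rw [h12, h12, h₁ b, h₂ b, h₁, h₂, h₁ 0, h₂ 0, h₁ (_ + _), h₂ (_ + _)]
      ext <;> simp [smul_sub, h₂ _ 0]
      abel
  exact key a b c

theorem dynkin_of (x : X) : dynkin R X (of R x) = of R x := by
  simp [dynkin, toFreeAlgebra, bracketingRep]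

theorem dynkin_lie (a b : FreeLieAlgebra R X) :
    dynkin R X ⁅a, b⁆ = ⁅dynkin R X a, b⁆ + ⁅a, dynkin R X b⁆ := by
  have : dynkin R X ⁅a, b⁆ = (bracketingRep R X (toFreeAlgebra R X ⁅a, b⁆) (0, 1)).1 := rfl
  rw [this, LieHom.map_lie, LieRing.of_associative_ring_bracket]
  simp only [map_sub, map_mul, LinearMap.sub_apply, Module.End.mul_apply,
    bracketingRep_toFreeAlgebra]
  simp
  rw [← lie_skew (dynkin R X a)]
  abel

theorem iSup_eigenspace_dynkin :
    ⨆ n : ℕ, (dynkin R X).eigenspace ((n + 1 : ℕ) : R) = ⊤ := by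
  rw [eq_top_iff]
  rintro a -
  induction a using span_induction with
  | of x => exact Submodule.mem_iSup_of_mem 0 (by simp [dynkin_of])
  | zero => exact zero_mem _
  | add a b ha hb => exact add_mem ha hb
  | smul c a ha => exact Submodule.smul_mem _ _ ha
  | lie a b ha hb =>
    induction ha using Submodule.iSup_induction' with
    | zero => simp
    | add x y _ _ hx hy => rw [add_lie]; exact add_mem hx hy
    | mem i x hx =>
      induction hb using Submodule.iSup_induction' with
      | zero => simp
      | add x y _ _ hx hy => rw [lie_add]; exact add_mem hx hy
      | mem j y hy =>
        refine Submodule.mem_iSup_of_mem (i + j + 1) ?_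
        rw [Module.End.mem_eigenspace_iff] at *
        rw [dynkin_lie, hx, hy, smul_lie, lie_smul, ← add_smul]
        push_cast
        congr 1
        ring

theorem toFreeAlgebra_injective (K X : Type*) [Field K] [CharZero K] :
    Function.Injective (toFreeAlgebra K X) := by
  rw [injective_iff_map_eq_zero]
  intro a ha
  have h0 : a ∈ (dynkin K X).eigenspace 0 := by
    rw [Module.End.mem_eigenspace_iff]
    simp [dynkin, ha]
  have hind := Module.End.eigenspaces_iSupIndep (dynkin K X)
  have hdisj := hind 0
  have : (⊤ : Submodule K (FreeLieAlgebra K X)) ≤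
      ⨆ μ, ⨆ (_ : μ ≠ 0), (dynkin K X).eigenspace μ := by
    rw [← iSup_eigenspace_dynkin]
    exact iSup_le fun n => le_iSup₂_of_le ((n + 1 : ℕ) : K) (Nat.cast_ne_zero.2 n.succ_ne_zero) le_rfl
  exact Submodule.disjoint_def.1 hdisj a h0 (this trivial)

end FreeLieAlgebra

open TensorProduct

section WordMatrix

variable (K : Type*) [CommRing K] {X : Type*}

open scoped Classical in
/-- The matrix through which the letter `x` acts on the positions of the word `w`. -/
noncomputable def wordMatrix (w : List X) (x : X) :
    Matrix (Fin (w.length + 1)) (Fin (w.length + 1)) K :=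
  fun i j => if (j : ℕ) = i + 1 ∧ w[(i : ℕ)]? = some x then 1 else 0

/-- The representation of the free algebra on the positions of the word `w`. -/
noncomputable def wordRep (w : List X) :
    FreeAlgebra K X →ₐ[K] Matrix (Fin (w.length + 1)) (Fin (w.length + 1)) K :=
  FreeAlgebra.lift K (wordMatrix K w)

open scoped Classical in
theorem wordRep_prod_apply (w v : List X) (i j : Fin (w.length + 1)) :
    wordRep K w (v.map (FreeAlgebra.ι K)).prod i j =
      if v <+: w.drop i ∧ (j : ℕ) = i + v.length then 1 else 0 := by
  induction v generalizing i with
  | nil => simp [Matrix.one_apply, Fin.ext_iff, eq_comm]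
  | cons x v ih =>
    rw [List.map_cons, List.prod_cons, map_mul, Matrix.mul_apply]
    simp only [ih]
    simp only [wordRep, FreeAlgebra.lift_ι_apply, wordMatrix]
    by_cases hx : w[(i : ℕ)]? = some x
    · obtain ⟨hi, hx'⟩ := List.getElem?_eq_some_iff.1 hx
      rw [Finset.sum_eq_single ⟨i + 1, by omega⟩]
      · rw [List.drop_eq_getElem_cons hi, hx']
        simp [hx, List.cons_prefix_cons, add_left_comm, add_comm]
      · intro b _ hb
        rw [if_neg, zero_mul]
        rintro ⟨h, -⟩
        exact hb (Fin.ext h)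
      · simp
    · rw [Finset.sum_eq_zero, if_neg]
      · rintro ⟨⟨u, hu⟩, -⟩
        apply hx
        have := congrArg (fun l => l[0]?) hu
        simpa using this.symm
      · simp [hx]

theorem exists_wordRep_ne_zero {a : FreeAlgebra K X} (ha : a ≠ 0) :
    ∃ w : List X, wordRep K w a 0 (Fin.last _) ≠ 0 := by
  classical
  by_contra! h
  apply ha
  let e := FreeAlgebra.equivMonoidAlgebraFreeMonoid (R := K) (X := X)
  apply e.injective
  rw [map_zero]
  ext w
  have key : ∀ b : MonoidAlgebra K (FreeMonoid X),
      b.coeff w = wordRep K (FreeMonoid.toList w) (e.symm b) 0 (Fin.last _) := by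
    intro b
    induction b using MonoidAlgebra.induction_linear with
    | zero => simp
    | add f g hf hg => simp [hf, hg]
    | single v r =>
      have : e.symm (MonoidAlgebra.single v r) =
          r • ((FreeMonoid.toList v).map (FreeAlgebra.ι K)).prod := by
        change MonoidAlgebra.lift K (FreeAlgebra K X) (FreeMonoid X)
          (FreeMonoid.lift (FreeAlgebra.ι K)) (MonoidAlgebra.single v r) = _
        rw [MonoidAlgebra.lift_single, FreeMonoid.lift_apply]
      rw [this, map_smul, Matrix.smul_apply, wordRep_prod_apply]
      have h2 : (v.toList <+: w.toList.drop (0 : Fin (w.toList.length + 1)) ∧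
          (Fin.last w.toList.length : ℕ) = (0 : Fin (w.toList.length + 1)) + v.toList.length) ↔
            v = w := by
        simp only [Fin.coe_ofNat_eq_mod, Nat.zero_mod, List.drop_zero, Fin.val_last, zero_add]
        constructor
        · rintro ⟨h1, h2⟩
          exact FreeMonoid.toList.injective (h1.eq_of_length h2.symm)
        · rintro rfl
          simp
      simp only [h2]
      simp [Finsupp.single_apply]
  rw [key]
  simpa using h _

end WordMatrix

section SquareZero

open MvPolynomial

/-- A commutative algebra with generators `t i` of square zero and a functional detecting the
product of the first `n` of them. -/
theorem exists_squareZero_algebra (K : Type*) [Field K] (n : ℕ) :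
    ∃ (I : Ideal (MvPolynomial ℕ K)) (t : ℕ → MvPolynomial ℕ K ⧸ I)
      (c : (MvPolynomial ℕ K ⧸ I) →ₗ[K] K),
      (∀ i, t i * t i = 0) ∧
      ∀ s : Finset ℕ, c (∏ k ∈ s, t k) = if s = Finset.range n then 1 else 0 := by
  classical
  let S : Set (ℕ →₀ ℕ) := Set.range fun i => Finsupp.single i 2
  let I : Ideal (MvPolynomial ℕ K) := Ideal.span ((fun s => monomial s (1 : K)) '' S)
  let μ : Finset ℕ → ℕ →₀ ℕ := fun s => ∑ k ∈ s, Finsupp.single k 1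
  have hμ (s : Finset ℕ) (i : ℕ) : μ s i = if i ∈ s then 1 else 0 := by
    simp [μ, Finsupp.single_apply]
  have hc : I.restrictScalars K ≤ LinearMap.ker (lcoeff K (μ (Finset.range n))) := by
    intro p hp
    rw [Submodule.restrictScalars_mem, mem_ideal_span_monomial_image] at hp
    rw [LinearMap.mem_ker, lcoeff_apply]
    by_contra h
    obtain ⟨_, ⟨i, rfl⟩, hi⟩ := hp _ (mem_support_iff.2 h)
    have := hi i
    rw [hμ] at this
    simp only [Finsupp.single_eq_same] at this
    split_ifs at this <;> omega
  refine ⟨I, fun i => Ideal.Quotient.mk I (X i),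
    ((I.restrictScalars K).liftQ _ hc).comp
      (Submodule.Quotient.restrictScalarsEquiv K I).symm.toLinearMap, fun i => ?_, fun s => ?_⟩
  · rw [← map_mul, Ideal.Quotient.eq_zero_iff_mem]
    apply Ideal.subset_span
    refine ⟨_, ⟨i, rfl⟩, ?_⟩
    simp [X, monomial_mul]
    rw [← Finsupp.single_add]
  · rw [← map_prod]
    have : (∏ k ∈ s, X k : MvPolynomial ℕ K) = monomial (μ s) 1 := by
      simp [X, μ, monomial_sum_one]
    have h1 : (((I.restrictScalars K).liftQ _ hc).comp
      (Submodule.Quotient.restrictScalarsEquiv K I).symm.toLinearMap)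
        (Ideal.Quotient.mk I (∏ k ∈ s, X k)) =
        coeff (μ (Finset.range n)) (∏ k ∈ s, X k : MvPolynomial ℕ K) := rfl
    rw [h1, this, coeff_monomial]
    refine if_congr ⟨fun h => ?_, fun h => by rw [h]⟩ rfl rfl
    ext i
    have := DFunLike.congr_fun h i
    rw [hμ, hμ] at this
    split_ifs at this <;> simp_all

end SquareZero

section Chain

theorem sum_lie_smul_of_matrixUnits {ι K V : Type*} [Fintype ι] [DecidableEq ι] [CommRing K]
    [LieRing V] [LieAlgebra K V] (T : ι → ι → V) {M N : Matrix ι ι K}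
    (h : ∀ i j k l, ⁅M i j • T i j, N k l • T k l⁆ =
      (if j = k then (M i j * N k l) • T i l else 0) -
        (if l = i then (N k l * M i j) • T k j else 0)) :
    ∑ i, ∑ j, ⁅M, N⁆ i j • T i j = ⁅∑ i, ∑ j, M i j • T i j, ∑ i, ∑ j, N i j • T i j⁆ := by
  have hmul : ∀ M N : Matrix ι ι K,
      ∑ i, ∑ l, (M * N) i l • T i l = ∑ i, ∑ j, ∑ l, (M i j * N j l) • T i l := by
    intro M N
    simp only [Matrix.mul_apply, Finset.sum_smul]
    exact Finset.sum_congr rfl fun i _ => Finset.sum_comm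
  simp only [LieRing.of_associative_ring_bracket, Matrix.sub_apply, sub_smul,
    Finset.sum_sub_distrib, hmul, sum_lie, lie_sum, h]
  congr 1
  · simp only [Finset.sum_ite_eq', Finset.mem_univ, if_true]
    rw [Finset.sum_comm]
    exact Finset.sum_congr rfl fun i _ => Finset.sum_comm
  · refine Finset.sum_congr rfl fun i _ => Finset.sum_congr rfl fun j _ => ?_
    rw [Finset.sum_comm]
    simp

variable {K G X : Type*} [Field K] [LieRing G] [LieAlgebra K G]

/-- The right-normed bracket `⁅e i, ⁅e (i + 1), …, e (i + k)⁆⁆`. -/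
def chainBracket (e : ℕ → G) : ℕ → ℕ → G
  | i, 0 => e i
  | i, k + 1 => ⁅e i, chainBracket e (i + 1) k⁆

variable {e : ℕ → G} {n : ℕ}

theorem lie_chainBracket_eq_zero {x : G} {j l : ℕ}
    (h : ∀ i, j ≤ i → i ≤ j + l → ⁅x, e i⁆ = 0) : ⁅x, chainBracket e j l⁆ = 0 := by
  induction l generalizing j with
  | zero => exact h j le_rfl (by omega)
  | succ l ih =>
    rw [chainBracket, leibniz_lie, h j le_rfl (by omega), ih fun i h1 h2 => h i (by omega) (by omega)]
    simp

theorem lie_chainBracket_chainBracket_of_lt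
    (he : ∀ i j, i + 1 < j → j < n → ⁅e i, e j⁆ = 0) {i j k l : ℕ}
    (h : i + k + 1 < j) (hn : j + l < n) : ⁅chainBracket e i k, chainBracket e j l⁆ = 0 := by
  rw [← lie_skew, neg_eq_zero]
  refine lie_chainBracket_eq_zero fun a ha ha' => ?_
  rw [← lie_skew, neg_eq_zero]
  exact lie_chainBracket_eq_zero fun b hb hb' => he _ _ (by omega) (by omega)

theorem lie_chainBracket_chainBracket
    (he : ∀ i j, i + 1 < j → j < n → ⁅e i, e j⁆ = 0) {i k l : ℕ} (hn : i + k + 1 + l < n) :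
    ⁅chainBracket e i k, chainBracket e (i + k + 1) l⁆ = chainBracket e i (k + l + 1) := by
  induction k generalizing i with
  | zero => simp [chainBracket]
  | succ k ih =>
    have h1 : ⁅e i, chainBracket e (i + (k + 1) + 1) l⁆ = 0 :=
      lie_chainBracket_eq_zero fun b hb hb' => he _ _ (by omega) (by omega)
    have h2 := ih (i := i + 1) (by omega)
    rw [show i + 1 + k + 1 = i + (k + 1) + 1 by omega] at h2
    rw [chainBracket, lie_lie, h1, h2, lie_zero, sub_zero,
      show k + 1 + l + 1 = (k + l + 1) + 1 by omega]
    rfl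

variable {A : Type*} [CommRing A] [Algebra K A] (t : ℕ → A)

variable (K e) in
/-- The image of the matrix unit at `(i, j)`. -/
noncomputable def chainUnit (i j : ℕ) : A ⊗[K] G :=
  (∏ k ∈ Finset.Ico i j, t k) ⊗ₜ chainBracket e i (j - i - 1)

theorem lie_chainUnit (ht : ∀ i, t i * t i = 0)
    (he : ∀ i j, i + 1 < j → j < n → ⁅e i, e j⁆ = 0) {i j k l : ℕ}
    (hij : i < j) (hkl : k < l) (hj : j ≤ n) (hl : l ≤ n) :
    ⁅chainUnit K e t i j, chainUnit K e t k l⁆ =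
      (if j = k then chainUnit K e t i l else 0) - (if l = i then chainUnit K e t k j else 0) := by
  have adj : ∀ {i j l}, i < j → j < l → l ≤ n →
      ⁅chainUnit K e t i j, chainUnit K e t j l⁆ = chainUnit K e t i l := by
    intro i j l h1 h2 h3
    rw [chainUnit, chainUnit, chainUnit, LieAlgebra.ExtendScalars.bracket_tmul,
      Finset.prod_Ico_consecutive _ h1.le h2.le]
    have := lie_chainBracket_chainBracket (e := e) he (i := i) (k := j - i - 1) (l := l - j - 1)
      (by omega)
    rw [show i + (j - i - 1) + 1 = j by omega,
      show j - i - 1 + (l - j - 1) + 1 = l - i - 1 by omega] at this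
    rw [this]
  have far : ∀ {i j k l}, i < j → j < k → k < l → l ≤ n →
      ⁅chainUnit K e t i j, chainUnit K e t k l⁆ = 0 := by
    intro i j k l h1 h2 h3 h4
    rw [chainUnit, chainUnit, LieAlgebra.ExtendScalars.bracket_tmul,
      lie_chainBracket_chainBracket_of_lt he (by omega) (by omega), tmul_zero]
  rcases lt_trichotomy j k with h | h | h
  · rw [if_neg h.ne, if_neg (by omega), far hij h hkl hl, sub_zero]
  · subst h
    rw [if_pos rfl, if_neg (by omega), adj hij hkl hl, sub_zero]
  rcases lt_trichotomy l i with h' | h' | h'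
  · rw [if_neg h.ne', if_neg h'.ne, ← lie_skew, far hkl h' hij hj]
    simp
  · subst h'
    rw [if_neg h.ne', if_pos rfl, ← lie_skew, adj hkl hij hj, zero_sub]
  · rw [if_neg h.ne', if_neg h'.ne', chainUnit, chainUnit, LieAlgebra.ExtendScalars.bracket_tmul]
    have h1 : max i k ∈ Finset.Ico i j := by simp; omega
    have h2 : max i k ∈ Finset.Ico k l := by simp; omega
    rw [← Finset.mul_prod_erase _ _ h1, ← Finset.mul_prod_erase _ _ h2, mul_mul_mul_comm, ht,
      zero_mul, zero_tmul, sub_zero]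

variable (K e n) in
/-- The linear extension of `chainUnit` to matrices; it respects brackets of strictly upper
triangular matrices. -/
noncomputable def chainMap : Matrix (Fin (n + 1)) (Fin (n + 1)) K →ₗ[K] A ⊗[K] G where
  toFun M := ∑ i, ∑ j, M i j • chainUnit K e t i j
  map_add' M N := by simp [add_smul, Finset.sum_add_distrib]
  map_smul' c M := by simp [mul_smul, Finset.smul_sum]

theorem chainMap_lie (ht : ∀ i, t i * t i = 0)
    (he : ∀ i j, i + 1 < j → j < n → ⁅e i, e j⁆ = 0) {M N : Matrix (Fin (n + 1)) (Fin (n + 1)) K}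
    (hM : ∀ i j, j ≤ i → M i j = 0) (hN : ∀ i j, j ≤ i → N i j = 0) :
    chainMap K e n t ⁅M, N⁆ = ⁅chainMap K e n t M, chainMap K e n t N⁆ := by
  have h : ∀ i j k l : Fin (n + 1), ⁅M i j • chainUnit K e t i j, N k l • chainUnit K e t k l⁆ =
      (if j = k then (M i j * N k l) • chainUnit K e t i l else 0) -
        (if l = i then (N k l * M i j) • chainUnit K e t k j else 0) := by
    intro i j k l
    by_cases hij : j ≤ i
    · simp [hM i j hij]
    by_cases hkl : l ≤ k
    · simp [hN k l hkl]
    rw [smul_lie, lie_smul, lie_chainUnit t ht he (by simpa using hij) (by simpa using hkl)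
      (by omega) (by omega), smul_smul, smul_sub]
    simp only [Fin.ext_iff, smul_ite, smul_zero, mul_comm]
  exact sum_lie_smul_of_matrixUnits (fun i j : Fin (n + 1) => chainUnit K e t i j) h

theorem lift_chainMap (ht : ∀ i, t i * t i = 0) (w : List X)
    (he : ∀ i j, i + 1 < j → j < w.length → ⁅e i, e j⁆ = 0) (a : FreeLieAlgebra K X) :
    (∀ i j, j ≤ i → wordRep K w (FreeLieAlgebra.toFreeAlgebra K X a) i j = 0) ∧
    FreeLieAlgebra.lift K (fun x => chainMap K e w.length t (wordMatrix K w x)) a =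
      chainMap K e w.length t (wordRep K w (FreeLieAlgebra.toFreeAlgebra K X a)) := by
  induction a using FreeLieAlgebra.span_induction with
  | of x =>
    constructor
    · intro i j hij
      simp only [FreeLieAlgebra.toFreeAlgebra, FreeLieAlgebra.lift_of_apply, wordRep,
        FreeAlgebra.lift_ι_apply, wordMatrix]
      rw [if_neg]
      rintro ⟨h, -⟩
      have : (j : ℕ) ≤ i := hij
      omega
    · simp [FreeLieAlgebra.toFreeAlgebra, wordRep]
  | zero => simp
  | add a b ha hb =>
    refine ⟨fun i j hij => ?_, by simp only [map_add, ha.2, hb.2]⟩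
    rw [map_add, map_add, Matrix.add_apply, ha.1 i j hij, hb.1 i j hij, add_zero]
  | smul c a ha =>
    refine ⟨fun i j hij => ?_, by simp only [map_smul, ha.2]⟩
    rw [map_smul, map_smul, Matrix.smul_apply, ha.1 i j hij, smul_zero]
  | lie a b ha hb =>
    have h : wordRep K w (FreeLieAlgebra.toFreeAlgebra K X ⁅a, b⁆) =
        ⁅wordRep K w (FreeLieAlgebra.toFreeAlgebra K X a),
          wordRep K w (FreeLieAlgebra.toFreeAlgebra K X b)⁆ := by
      simp [LieRing.of_associative_ring_bracket]
    have hmul : ∀ {M N : Matrix (Fin (w.length + 1)) (Fin (w.length + 1)) K},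
        (∀ i j, j ≤ i → M i j = 0) → (∀ i j, j ≤ i → N i j = 0) →
        ∀ i j, j ≤ i → (M * N) i j = 0 := by
      intro M N hM hN i j hij
      rw [Matrix.mul_apply]
      refine Finset.sum_eq_zero fun k _ => ?_
      rcases le_total k i with hk | hk
      · rw [hM i k hk, zero_mul]
      · rw [hN k j (hij.trans hk), mul_zero]
    rw [h]
    constructor
    · intro i j hij
      rw [LieRing.of_associative_ring_bracket, Matrix.sub_apply, hmul ha.1 hb.1 i j hij,
        hmul hb.1 ha.1 i j hij, sub_zero]
    · rw [LieHom.map_lie, ha.2, hb.2, chainMap_lie t ht he ha.1 hb.1]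

/-- A nonzero Lie polynomial is not an identity of all scalar extensions of a Lie algebra in which
sufficiently long chains of elements do not vanish. -/
theorem FreeLieAlgebra.exists_lift_ne_zero [CharZero K] {P : FreeLieAlgebra K X} (hP : P ≠ 0) :
    ∃ n : ℕ, ∀ {G : Type*} [LieRing G] [LieAlgebra K G] (e : ℕ → G),
      (∀ i j, i + 1 < j → j < n + 1 → ⁅e i, e j⁆ = 0) → chainBracket e 0 n ≠ 0 →
      ∃ (I : Ideal (MvPolynomial ℕ K))
        (f : FreeLieAlgebra K X →ₗ⁅K⁆ (MvPolynomial ℕ K ⧸ I) ⊗[K] G), f P ≠ 0 := by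
  obtain ⟨w, hw⟩ := exists_wordRep_ne_zero K
    ((map_ne_zero_iff _ (FreeLieAlgebra.toFreeAlgebra_injective K X)).2 hP)
  refine ⟨w.length - 1, fun {G} _ _ e he hne => ?_⟩
  obtain ⟨I, t, c, ht, hc⟩ := exists_squareZero_algebra K w.length
  obtain ⟨hu, hf⟩ := lift_chainMap t ht w (fun i j h1 h2 => he i j h1 (by omega)) P
  refine ⟨I, FreeLieAlgebra.lift K fun x => chainMap K e w.length t (wordMatrix K w x),
    fun h0 => ?_⟩
  rw [hf] at h0
  set M := wordRep K w (FreeLieAlgebra.toFreeAlgebra K X P)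
  have hpos : 0 < w.length := by
    by_contra h
    exact hw (hu _ _ (by rw [Fin.le_def, Fin.val_last]; omega))
  have key := congrArg ((TensorProduct.lid K G).toLinearMap ∘ₗ c.rTensor G) h0
  have hterm : ∀ i j : Fin (w.length + 1),
      M i j • ((TensorProduct.lid K G).toLinearMap ∘ₗ c.rTensor G) (chainUnit K e t i j) =
        if i = 0 ∧ j = Fin.last _ then M i j • chainBracket e 0 (w.length - 1) else 0 := by
    intro i j
    by_cases hij : j ≤ i
    · rw [hu i j hij, zero_smul, zero_smul, ite_self]
    have hij' : (i : ℕ) < j := by simpa using hij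
    have hiff : Finset.Ico (i : ℕ) j = Finset.range w.length ↔ i = 0 ∧ j = Fin.last _ := by
      rw [Finset.range_eq_Ico, Fin.ext_iff, Fin.ext_iff]
      constructor
      · intro h
        have h1 : (i : ℕ) = 0 := by
          have := (Finset.ext_iff.1 h 0).2 (by simpa using hpos)
          simp at this
          simp [this.1]
        have h2 := congrArg Finset.card h
        simp at h2
        refine ⟨h1, ?_⟩
        simp
        omega
      · rintro ⟨h1, h2⟩
        simp at h1 h2
        rw [h1, h2]
        simp
    simp only [chainUnit, LinearMap.comp_apply, LinearMap.rTensor_tmul, LinearEquiv.coe_coe,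
      TensorProduct.lid_tmul, hc, hiff]
    split_ifs with h
    · rw [h.1, h.2]
      simp
    · simp
  rw [map_zero] at key
  simp only [chainMap, LinearMap.coe_mk, AddHom.coe_mk, map_sum, map_smul, hterm] at key
  rw [Finset.sum_eq_single 0 (by intro b _ hb; simp [hb]) (by simp),
    Finset.sum_eq_single (Fin.last _) (by intro b _ hb; simp [hb]) (by simp)] at key
  simp only [and_self, if_true] at key
  exact (smul_ne_zero hw hne) key

end Chain

section Identity

variable {K G X : Type*} [Field K] [LieRing G] [LieAlgebra K G]

variable (G) in
/-- Specialisation of the scalars of a scalar extension along a point. -/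
noncomputable def LieAlgebra.specialize {A : Type*} [CommRing A] [Algebra K A] (p : A →ₐ[K] K) :
    A ⊗[K] G →ₗ⁅K⁆ G :=
  { (TensorProduct.lid K G).toLinearMap ∘ₗ p.toLinearMap.rTensor G with
    map_lie' := by
      intro x y
      induction x with
      | zero => simp
      | add a b ha hb => simp_all [add_lie]
      | tmul a u =>
        induction y with
        | zero => simp
        | add a b ha hb => simp_all [lie_add]
        | tmul b v => simp [mul_smul, smul_comm (p a)] }

theorem LieAlgebra.specialize_tmul {A : Type*} [CommRing A] [Algebra K A] (p : A →ₐ[K] K)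
    (a : A) (x : G) : LieAlgebra.specialize G p (a ⊗ₜ x) = p a • x := by
  change TensorProduct.lid K G (p.toLinearMap.rTensor G (a ⊗ₜ x)) = _
  simp

/-- Over an infinite field, an identity of a Lie algebra remains an identity of every scalar
extension. -/
theorem FreeLieAlgebra.apply_eq_zero_of_baseChange [Infinite K] {P : FreeLieAlgebra K X}
    (h : ∀ f : FreeLieAlgebra K X →ₗ⁅K⁆ G, f P = 0) {B : Type*} [CommRing B] [Algebra K B]
    (f : FreeLieAlgebra K X →ₗ⁅K⁆ B ⊗[K] G) : f P = 0 := by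
  classical
  let b := Module.Basis.ofVectorSpace K G
  let β := fun x => TensorProduct.equivFinsuppOfBasisRight (M := B) b (f (FreeLieAlgebra.of K x))
  let F : FreeLieAlgebra K X →ₗ⁅K⁆ MvPolynomial (X × _) K ⊗[K] G :=
    FreeLieAlgebra.lift K fun x => ∑ l ∈ (β x).support, MvPolynomial.X (x, l) ⊗ₜ b l
  have hf : (LieAlgebra.ExtendScalars.map (MvPolynomial.aeval fun q => β q.1 q.2) LieHom.id).comp F
      = f := by
    ext x
    apply (TensorProduct.equivFinsuppOfBasisRight (M := B) b).injective
    have : (TensorProduct.equivFinsuppOfBasisRight (M := B) b) (f (FreeLieAlgebra.of K x)) = β x :=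
      rfl
    rw [this, ← LinearEquiv.eq_symm_apply]
    simp [F, LieAlgebra.ExtendScalars.map_apply_tmul, Finsupp.sum]
  have hF : F P = 0 := by
    apply (TensorProduct.equivFinsuppOfBasisRight (M := MvPolynomial (X × _) K) b).injective
    rw [map_zero]
    ext1 l
    apply MvPolynomial.funext
    intro p
    have key : ∀ z : MvPolynomial (X × _) K ⊗[K] G,
        MvPolynomial.eval p (TensorProduct.equivFinsuppOfBasisRight b z l) =
          b.repr (LieAlgebra.specialize G (MvPolynomial.aeval p) z) l := by
      intro z
      induction z with
      | zero => simp
      | add x y hx hy => simp [hx, hy]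
      | tmul a x =>
        simp [LieAlgebra.specialize_tmul, MvPolynomial.aeval_eq_eval, mul_comm]
    rw [key]
    have := h ((LieAlgebra.specialize G (MvPolynomial.aeval p)).comp F)
    rw [LieHom.comp_apply] at this
    rw [this]
    simp
  rw [← hf, LieHom.comp_apply, hF, map_zero]

end Identity

section InducedPath

/-- In a connected graph with all degrees at most `d`, balls grow at most exponentially. -/
theorem SimpleGraph.Connected.card_ball_le {V : Type*} [Fintype V] [DecidableEq V]
    {G : SimpleGraph V} [DecidableRel G.Adj] (hG : G.Connected) {d : ℕ}
    (hd : ∀ v, G.degree v ≤ d) (u : V) (k : ℕ) :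
    (Finset.univ.filter fun v => G.dist u v ≤ k).card ≤ (d + 1) ^ k := by
  induction k with
  | zero =>
    simp only [Nat.le_zero, hG.dist_eq_zero_iff, pow_zero]
    rw [Finset.filter_eq]
    simp
  | succ k ih =>
    have hsub : (Finset.univ.filter fun v => G.dist u v ≤ k + 1) ⊆
        (Finset.univ.filter fun v => G.dist u v ≤ k).biUnion
          fun v => insert v (G.neighborFinset v) := by
      intro v hv
      simp only [Finset.mem_filter, Finset.mem_univ, true_and, Finset.mem_biUnion,
        Finset.mem_insert, SimpleGraph.mem_neighborFinset] at hv ⊢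
      obtain hv' | hv' := Nat.lt_or_ge (G.dist u v) (k + 1)
      · exact ⟨v, by omega, .inl rfl⟩
      · obtain ⟨p, hp⟩ := hG.exists_walk_length_eq_dist u v
        refine ⟨p.getVert k, ?_, .inr ?_⟩
        · exact (SimpleGraph.dist_le (p.take k)).trans (by simp)
        · have := p.adj_getVert_succ (i := k) (by omega)
          rwa [show k + 1 = p.length by omega, p.getVert_length] at this
    calc _ ≤ _ := Finset.card_le_card hsub
      _ ≤ (Finset.univ.filter fun v => G.dist u v ≤ k).card * (d + 1) := by
        refine Finset.card_biUnion_le_card_mul _ _ _ fun v _ => ?_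
        exact (Finset.card_insert_le _ _).trans (by simpa using hd v)
      _ ≤ (d + 1) ^ (k + 1) := by
        rw [pow_succ]
        gcongr

/-- A large connected graph of bounded degree contains a long induced path. -/
theorem SimpleGraph.Connected.exists_induced_path {V : Type*} [Fintype V] [DecidableEq V]
    {G : SimpleGraph V} [DecidableRel G.Adj] (hG : G.Connected) {d n : ℕ}
    (hd : ∀ v, G.degree v ≤ d) (hV : (d + 1) ^ n < Fintype.card V) :
    ∃ a : ℕ → V, (∀ i < n, G.Adj (a i) (a (i + 1))) ∧
      ∀ i j, i + 1 < j → j ≤ n → a i ≠ a j ∧ ¬ G.Adj (a i) (a j) := by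
  obtain ⟨u⟩ := hG.nonempty
  obtain ⟨v, hv⟩ : ∃ v, n < G.dist u v := by
    by_contra! h
    have := hG.card_ball_le hd u n
    rw [Finset.filter_true_of_mem fun v _ => h v, Finset.card_univ] at this
    omega
  obtain ⟨p, hp⟩ := hG.exists_walk_length_eq_dist u v
  refine ⟨p.getVert, fun i hi => p.adj_getVert_succ (by omega), fun i j hij hj => ?_⟩
  have h₁ : G.dist u (p.getVert i) ≤ i := (SimpleGraph.dist_le (p.take i)).trans (by simp)
  have h₂ : G.dist (p.getVert j) v ≤ p.length - j :=
    (SimpleGraph.dist_le (p.drop j)).trans (by simp)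
  have h₃ := hG.dist_triangle (u := u) (v := p.getVert i) (w := v)
  have h₄ := hG.dist_triangle (u := p.getVert i) (v := p.getVert j) (w := v)
  have h₅ : 2 ≤ G.dist (p.getVert i) (p.getVert j) := by omega
  constructor
  · intro h
    rw [h, SimpleGraph.dist_self] at h₅
    omega
  · intro h
    rw [SimpleGraph.dist_eq_one_iff_adj.mpr h] at h₅
    omega

end InducedPath

namespace RootPairing.Base

variable {ι R M N : Type*} [Finite ι] [CommRing R] [CharZero R] [IsDomain R] [AddCommGroup M]
  [Module R M] [AddCommGroup N] [Module R N] {P : RootPairing ι R M N} [P.IsCrystallographic]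
  (b : P.Base)

/-- Adding simple roots adjacent to a given simple root yields a root. -/
theorem exists_root_eq_add_sum (i : b.support) (T : Finset b.support)
    (hT : ∀ j ∈ T, j ≠ i ∧ b.cartanMatrix i j ≠ 0) :
    ∃ k, P.root k = P.root i + ∑ j ∈ T, P.root j ∧ 0 < b.height k := by
  classical
  induction T using Finset.induction_on with
  | empty => exact ⟨i, by simp, by simp [b.height_one_of_mem_support i.2]⟩
  | insert j T hj ih =>
    obtain ⟨k, hk, hpos⟩ := ih fun l hl => hT l (Finset.mem_insert_of_mem hl)
    obtain ⟨hji, hij⟩ := hT j (Finset.mem_insert_self _ _)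
    have hneg : P.pairingIn ℤ k j < 0 := by
      have h₁ : P.pairing k j = P.pairing i j + ∑ l ∈ T, P.pairing l j := by
        simp only [← P.root_coroot'_eq_pairing, hk, map_add, map_sum]
      have h₂ : P.pairingIn ℤ k j = b.cartanMatrix i j + ∑ l ∈ T, b.cartanMatrix l j := by
        apply FaithfulSMul.algebraMap_injective ℤ R
        simp only [map_add, map_sum, cartanMatrix, cartanMatrixIn_def, P.algebraMap_pairingIn, h₁]
      have h₃ : b.cartanMatrix i j < 0 :=
        lt_of_le_of_ne (b.cartanMatrix_le_zero_of_ne i j hji.symm) hij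
      have h₄ : ∑ l ∈ T, b.cartanMatrix l j ≤ 0 := Finset.sum_nonpos fun l hl =>
        b.cartanMatrix_le_zero_of_ne l j fun h => hj (h ▸ hl)
      omega
    have hne : P.root k ≠ -P.root j := by
      intro h
      have hjk : P.root j = P.root k + (2 : ℤ) • P.root j := by
        rw [h, two_smul]
        abel
      have := b.height_add_zsmul hjk
      rw [b.height_one_of_mem_support j.2, smul_eq_mul] at this
      omega
    obtain ⟨l, hl⟩ := P.root_add_root_mem_of_pairingIn_neg hneg hne
    refine ⟨l, ?_, ?_⟩
    · rw [hl, hk, Finset.sum_insert hj]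
      abel
    · rw [b.height_add hl, b.height_one_of_mem_support j.2]
      omega

/-- A vertex of the Dynkin diagram has at most six neighbours. -/
theorem card_le_six_of_cartanMatrix_ne_zero (i : b.support) (T : Finset b.support)
    (hT : ∀ j ∈ T, j ≠ i ∧ b.cartanMatrix i j ≠ 0) : T.card ≤ 6 := by
  obtain ⟨k, hk, -⟩ := b.exists_root_eq_add_sum i T hT
  have h₁ : P.pairing k i = P.pairing i i + ∑ l ∈ T, P.pairing l i := by
    simp only [← P.root_coroot'_eq_pairing, hk, map_add, map_sum]
  have h₂ : P.pairingIn ℤ k i = b.cartanMatrix i i + ∑ l ∈ T, b.cartanMatrix l i := by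
    apply FaithfulSMul.algebraMap_injective ℤ R
    simp only [map_add, map_sum, cartanMatrix, cartanMatrixIn_def, P.algebraMap_pairingIn, h₁]
  have h₃ : ∑ l ∈ T, b.cartanMatrix l i ≤ ∑ l ∈ T, (-1 : ℤ) := by
    refine Finset.sum_le_sum fun l hl => ?_
    have := b.cartanMatrix_le_zero_of_ne l i (hT l hl).1
    have := mt b.cartanMatrix_apply_eq_zero_iff_symm.mp (hT l hl).2
    omega
  rw [Finset.sum_const, nsmul_eq_mul] at h₃
  have h₄ : -4 ≤ P.pairingIn ℤ k i := by
    have := P.pairingIn_pairingIn_mem_set_of_isCrystallographic k i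
    simp only [Set.mem_insert_iff, Set.mem_singleton_iff, Prod.mk.injEq] at this
    omega
  rw [b.cartanMatrix_apply_same] at h₂
  omega

/-- The underlying simple graph of the Dynkin diagram. -/
def dynkinGraph : SimpleGraph b.support where
  Adj i j := i ≠ j ∧ b.cartanMatrix i j ≠ 0
  symm := ⟨fun _ _ h => ⟨h.1.symm, mt b.cartanMatrix_apply_eq_zero_iff_symm.mp h.2⟩⟩
  loopless := ⟨fun _ h => h.1 rfl⟩

theorem dynkinGraph_connected [P.IsReduced] [P.IsIrreducible] [Nonempty ι] :
    b.dynkinGraph.Connected := by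
  have : Nonempty b.support := b.support_nonempty.to_subtype
  refine ⟨fun i j => ?_⟩
  refine b.induction_on_cartanMatrix (b.dynkinGraph.Reachable i) (i := i) .rfl fun k l hk hkl => ?_
  obtain rfl | h := eq_or_ne l k
  · exact hk
  · exact hk.trans (SimpleGraph.Adj.reachable (G := b.dynkinGraph) ⟨h, hkl⟩).symm

/-- The number of roots is bounded in terms of the rank. -/
theorem card_le_nine_pow [P.IsRootSystem] : Nat.card ι ≤ 9 ^ b.support.card := by
  have hmem : ∀ i j, P.pairingIn ℤ i j ∈ Finset.Icc (-4 : ℤ) 4 := by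
    intro i j
    have := P.pairingIn_pairingIn_mem_set_of_isCrystallographic i j
    simp only [Set.mem_insert_iff, Set.mem_singleton_iff, Prod.mk.injEq] at this
    rw [Finset.mem_Icc]
    omega
  have hinj : Function.Injective
      fun i (k : b.support) => (⟨P.pairingIn ℤ i k, hmem i k⟩ : Finset.Icc (-4 : ℤ) 4) := by
    intro i j h
    apply b.injective_pairingIn
    ext k
    exact congrArg Subtype.val (congrFun h k)
  refine (Nat.card_le_card_of_injective _ hinj).trans (le_of_eq ?_)
  rw [Nat.card_fun, Nat.card_eq_fintype_card, Nat.card_eq_fintype_card, Fintype.card_coe,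
    Fintype.card_coe, Int.card_Icc]
  rfl

/-- An irreducible root system of large rank has a long chain of simple roots. -/
theorem exists_chain [P.IsReduced] [P.IsIrreducible] [Nonempty ι] {n : ℕ}
    (hn : 7 ^ n < b.support.card) :
    ∃ a : ℕ → b.support, (∀ i < n, b.cartanMatrix (a (i + 1)) (a i) < 0) ∧
      ∀ i j, i + 1 < j → j ≤ n → a j ≠ a i ∧ b.cartanMatrix (a j) (a i) = 0 := by
  classical
  obtain ⟨a, h₁, h₂⟩ := b.dynkinGraph_connected.exists_induced_path (d := 6) (n := n)
    (fun i => b.card_le_six_of_cartanMatrix_ne_zero i (b.dynkinGraph.neighborFinset i)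
      fun j hj => by
        rw [SimpleGraph.mem_neighborFinset] at hj
        exact ⟨hj.1.symm, hj.2⟩) (by simpa using hn)
  refine ⟨a, fun i hi => ?_, fun i j hij hj => ⟨(h₂ i j hij hj).1.symm, ?_⟩⟩
  · have := (h₁ i hi).symm
    exact lt_of_le_of_ne (b.cartanMatrix_le_zero_of_ne _ _ this.1) this.2
  · by_contra h
    exact (h₂ i j hij hj).2 (SimpleGraph.Adj.symm ⟨(h₂ i j hij hj).1.symm, h⟩)

end RootPairing.Base

section RootSpaces

open LieAlgebra LieModule Module

/-- The dimension of a finite supremum of subspaces is at most the sum of the dimensions. -/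
theorem Submodule.finrank_biSup_le_sum {F V ι : Type*} [Field F] [AddCommGroup V] [Module F V]
    [FiniteDimensional F V] (p : ι → Submodule F V) (s : Finset ι) :
    finrank F ↥(⨆ i ∈ s, p i) ≤ ∑ i ∈ s, finrank F (p i) := by
  classical
  induction s using Finset.induction_on with
  | empty => simp
  | insert i s hi ih =>
    rw [Finset.iSup_insert, Finset.sum_insert hi]
    exact (Submodule.finrank_add_le_finrank_add_finrank _ _).trans (by gcongr)

namespace LieAlgebra.IsKilling

variable {F L : Type*} [Field F] [CharZero F] [LieRing L] [LieAlgebra F L] [FiniteDimensional F L]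
  [IsKilling F L] {H : LieSubalgebra F L} [H.IsCartanSubalgebra] [IsTriangularizable F H L]
  (b : (rootSystem H).Base)

/-- The dimension of a Killing Lie algebra is bounded in terms of its rank. -/
theorem finrank_le_of_base : finrank F L ≤ b.support.card + 9 ^ b.support.card := by
  have htop := cartan_sup_iSup_rootSpace_eq_top (K := F) (L := L) (H := H)
  rw [← LieSubmodule.toSubmodule_inj, LieSubmodule.sup_toSubmodule,
    LieSubmodule.iSup_toSubmodule] at htop
  simp only [LieSubmodule.iSup_toSubmodule, LieSubmodule.top_toSubmodule] at htop
  have hroots : (⨆ α : Weight F H L, ⨆ _ : α.IsNonZero, (rootSpace H α).toSubmodule) =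
      ⨆ α ∈ H.root, (rootSpace H α).toSubmodule := by simp
  have hH : finrank F H = b.support.card := by
    rw [finrank_eq_card_basis b.toCoweightBasis, Fintype.card_coe]
  have hsum : ∑ α ∈ H.root, finrank F (rootSpace H α).toSubmodule = H.root.card := by
    rw [Finset.card_eq_sum_ones]
    exact Finset.sum_congr rfl fun α hα => finrank_rootSpace_eq_one α (by simpa using hα)
  have hcard : H.root.card ≤ 9 ^ b.support.card := by
    have := b.card_le_nine_pow
    rwa [Nat.card_eq_fintype_card, Fintype.card_coe] at this
  calc finrank F L = finrank F (⊤ : Submodule F L) := finrank_top F L |>.symm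
    _ ≤ finrank F H.toLieSubmodule.toSubmodule +
        finrank F ↥(⨆ α ∈ H.root, (rootSpace H α).toSubmodule) := by
      rw [← htop, hroots]
      exact Submodule.finrank_add_le_finrank_add_finrank _ _
    _ ≤ b.support.card + 9 ^ b.support.card :=
      add_le_add hH.le ((Submodule.finrank_biSup_le_sum _ _).trans (hsum.trans_le hcard))

/-- Root vectors of distinct simple roots that are not adjacent in the Dynkin diagram commute. -/
theorem lie_eq_zero_of_cartanMatrix_eq_zero {i j : b.support} (hij : i ≠ j)
    (h : b.cartanMatrix i j = 0) {x y : L} (hx : x ∈ rootSpace H i.1.1)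
    (hy : y ∈ rootSpace H j.1.1) : ⁅x, y⁆ = 0 := by
  have hmem : ⁅x, y⁆ ∈ rootSpace H (i.1.1 + j.1.1 : H → F) :=
    lie_mem_genWeightSpace_of_mem_genWeightSpace hx hy
  by_contra hne
  have hbot : rootSpace H (i.1.1 + j.1.1 : H → F) ≠ ⊥ := by
    intro hb
    rw [hb] at hmem
    exact hne (by simpa using hmem)
  let χ : Weight F H L := ⟨_, hbot⟩
  have hχ : χ.IsNonZero := by
    intro h0
    refine b.root_ne_neg_of_ne i.2 j.2 (Subtype.coe_ne_coe.mpr hij) ?_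
    ext x
    have := congrFun h0 x
    exact eq_neg_of_add_eq_zero_left this
  refine (b.cartanMatrix_apply_eq_zero_iff hij).mp h ⟨⟨χ, by simpa using hχ⟩, ?_⟩
  ext x
  rfl

/-- A chain of simple roots gives a nonvanishing iterated bracket of root vectors. -/
theorem chainBracket_ne_zero {n : ℕ} {a : ℕ → b.support}
    (h₁ : ∀ i < n, b.cartanMatrix (a (i + 1)) (a i) < 0)
    (h₂ : ∀ i j, i + 1 < j → j ≤ n → a j ≠ a i ∧ b.cartanMatrix (a j) (a i) = 0)
    {h e f : ℕ → L} (ht : ∀ i, IsSl2Triple (h i) (e i) (f i))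
    (he : ∀ i, e i ∈ rootSpace H (a i).1.1) (hf : ∀ i, f i ∈ rootSpace H (-(a i).1.1)) (k : ℕ) :
    ∀ i, i + k ≤ n → chainBracket e i k ≠ 0 ∧
      chainBracket e i k ∈ rootSpace H (∑ l ∈ Finset.range (k + 1), ((a (i + l)).1.1 : H → F)) := by
  induction k with
  | zero =>
    intro i _
    simpa [chainBracket] using ⟨(ht i).e_ne_zero, he i⟩
  | succ k ih =>
    intro i hik
    obtain ⟨hne, hmem⟩ := ih (i + 1) (by omega)
    constructor
    · intro h0
      have hval : (∑ l ∈ Finset.range (k + 1), ((a (i + 1 + l)).1.1 : H → F))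
          (coroot (a i).1.1) = (b.cartanMatrix (a (i + 1)) (a i) : F) := by
        have hc : ∀ j, (a j).1.1 (coroot (a i).1.1) = (b.cartanMatrix (a j) (a i) : F) :=
          fun j => ((rootSystem H).algebraMap_pairingIn ℤ (a j).1 (a i).1).symm
        rw [Finset.sum_apply, Finset.sum_range_succ', Finset.sum_eq_zero, zero_add]
        · exact hc _
        · intro l hl
          rw [Finset.mem_range] at hl
          rw [hc, (h₂ i (i + 1 + (l + 1)) (by omega) (by omega)).2, Int.cast_zero]
      have hprim : (ht i).HasPrimitiveVectorWith (chainBracket e (i + 1) k)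
          (b.cartanMatrix (a (i + 1)) (a i) : F) :=
        { ne_zero := hne
          lie_h := by
            rw [(ht i).h_eq_coroot (LieSubalgebra.isNonZero_coe_root _) (he i) (hf i), ← hval]
            exact lie_eq_smul_of_mem_rootSpace hmem _
          lie_e := h0 }
      obtain ⟨m, hm⟩ := hprim.exists_nat
      have := h₁ i (by omega)
      have hm' : b.cartanMatrix (a (i + 1)) (a i) = m := by exact_mod_cast hm
      omega
    · rw [Finset.sum_range_succ', add_comm]
      simpa [add_assoc, add_comm 1, chainBracket] using
        lie_mem_genWeightSpace_of_mem_genWeightSpace (he i) hmem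

end LieAlgebra.IsKilling

/-- A simple Lie algebra of large dimension contains a long chain of elements, commuting when not
consecutive, whose iterated bracket does not vanish. -/
theorem LieAlgebra.IsSimple.exists_chain {F L : Type*} [Field F] [CharZero F] [IsAlgClosed F]
    [LieRing L] [LieAlgebra F L] [FiniteDimensional F L] [IsSimple F L] {n : ℕ}
    (hn : 7 ^ n + 9 ^ 7 ^ n < finrank F L) :
    ∃ e : ℕ → L, (∀ i j, i + 1 < j → j < n + 1 → ⁅e i, e j⁆ = 0) ∧ chainBracket e 0 n ≠ 0 := by
  obtain ⟨x, hx⟩ := exists_isCartanSubalgebra_engel F L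
  set H := LieSubalgebra.engel F x
  obtain ⟨b⟩ := (IsKilling.rootSystem H).nonempty_base
  have hcard : 7 ^ n < b.support.card := by
    by_contra! hle
    have := IsKilling.finrank_le_of_base b
    have : 9 ^ b.support.card ≤ 9 ^ 7 ^ n := Nat.pow_le_pow_right (by norm_num) hle
    omega
  have : Nonempty H.root := (Finset.card_pos.mp ((Nat.zero_le _).trans_lt hcard)).nonempty
  obtain ⟨a, h₁, h₂⟩ := b.exists_chain hcard
  choose h e f ht he hf using fun i =>
    IsKilling.exists_isSl2Triple_of_weight_isNonZero (LieSubalgebra.isNonZero_coe_root (a i).1)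
  refine ⟨e, fun i j hij hj => ?_,
    (IsKilling.chainBracket_ne_zero b h₁ h₂ ht he hf n 0 (by omega)).1⟩
  obtain ⟨hne, h0⟩ := h₂ i j hij (by omega)
  rw [← lie_skew, IsKilling.lie_eq_zero_of_cartanMatrix_eq_zero b hne h0 (he j) (he i), neg_zero]

end RootSpaces

section Centroid

open LieAlgebra Module

variable {K S : Type*} [Field K] [LieRing S] [LieAlgebra K S]
variable {F : Type*} [Field F] [Algebra K F]

/-- The Killing property is stable under extension of the base field. -/
theorem LieAlgebra.IsKilling.baseChange [FiniteDimensional K S] [IsKilling K S] :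
    IsKilling F (F ⊗[K] S) := by
  classical
  constructor
  rw [LieSubmodule.eq_bot_iff]
  intro z hz
  rw [LieIdeal.mem_killingCompl] at hz
  let c := Basis.ofVectorSpace K F
  have key : ∀ (w : F ⊗[K] S) (y : S) l, c.repr (killingForm F (F ⊗[K] S) (1 ⊗ₜ[K] y) w) l =
      killingForm K S y (TensorProduct.equivFinsuppOfBasisLeft c w l) := by
    intro w y l
    have hκ : killingForm F (F ⊗[K] S) = (killingForm K S).baseChange F :=
      LieModule.traceForm_baseChange ..
    rw [hκ]
    induction w with
    | zero => simp
    | add u v hu hv => simp [hu, hv]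
    | tmul a x =>
      simp [mul_comm]
  apply (TensorProduct.equivFinsuppOfBasisLeft c).injective
  rw [map_zero]
  ext1 l
  refine (IsKilling.killingForm_nondegenerate K S).2 _ fun y => ?_
  rw [← key, hz _ (LieSubmodule.mem_top _)]
  simp

/-- The centroid of a scalar extension is spanned by scalar extensions of centroid elements. -/
theorem centroid_baseChange_le [FiniteDimensional K S] :
    centroid F (F ⊗[K] S) ≤
      Submodule.span F ((LinearMap.baseChange F) '' (centroid K S : Set (S →ₗ[K] S))) := by
  classical
  intro θ hθ
  let c := Basis.ofVectorSpace K F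
  let φ := TensorProduct.equivFinsuppOfBasisLeft (N := S) c
  let d := Module.finBasis K S
  have hφ : ∀ (x : S) (z : F ⊗[K] S) l, φ ⁅(1 : F) ⊗ₜ[K] x, z⁆ l = ⁅x, φ z l⁆ := by
    intro x z l
    induction z with
    | zero => simp
    | add u v hu hv => simp [hu, hv]
    | tmul a y => simp [φ]
  let η : _ → (S →ₗ[K] S) := fun l =>
    Finsupp.lapply l ∘ₗ φ.toLinearMap ∘ₗ θ.restrictScalars K ∘ₗ TensorProduct.mk K F S 1
  have hη : ∀ l y, η l y = φ (θ (1 ⊗ₜ[K] y)) l := fun _ _ => rfl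
  have hmem : ∀ l, η l ∈ centroid K S := by
    intro l x y
    rw [hη, hη, ← hφ, ← hθ, LieAlgebra.ExtendScalars.bracket_tmul, one_mul]
  let T := Finset.univ.biUnion fun i => (φ (θ (1 ⊗ₜ[K] d i))).support
  have hsum : θ = ∑ l ∈ T, c l • (η l).baseChange F := by
    have : ∀ i, θ (1 ⊗ₜ[K] d i) = ∑ l ∈ T, c l ⊗ₜ[K] η l (d i) := by
      intro i
      apply φ.injective
      ext1 l
      rw [map_sum, Finsupp.finsetSum_apply]
      simp only [φ, TensorProduct.equivFinsuppOfBasisLeft_apply_tmul_apply, Basis.repr_self]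
      by_cases hl : l ∈ T
      · rw [Finset.sum_eq_single_of_mem l hl]
        · simp [hη, φ]
        · intro k _ hk
          simp [hk]
      · rw [Finset.sum_eq_zero]
        · have : l ∉ (φ (θ (1 ⊗ₜ[K] d i))).support := fun h =>
            hl (Finset.mem_biUnion.mpr ⟨i, Finset.mem_univ _, h⟩)
          exact Finsupp.notMem_support_iff.mp this
        · intro k hk
          have : k ≠ l := fun h => hl (h ▸ hk)
          simp [this]
    apply (d.baseChange F).ext
    intro i
    simp [this, TensorProduct.smul_tmul']
  rw [hsum]
  exact Submodule.sum_mem _ fun l _ =>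
    Submodule.smul_mem _ _ (Submodule.subset_span ⟨_, hmem l, rfl⟩)

/-- The dimension of the centroid does not grow under extension of the base field. -/
theorem finrank_centroid_baseChange_le [FiniteDimensional K S] :
    finrank F (centroid F (F ⊗[K] S)) ≤ finrank K (centroid K S) := by
  let B := Module.finBasis K (centroid K S)
  have hle : centroid F (F ⊗[K] S) ≤
      Submodule.span F (Set.range fun i => (B i).1.baseChange F) := by
    refine centroid_baseChange_le.trans (Submodule.span_le.mpr ?_)
    rintro _ ⟨θ, hθ, rfl⟩
    have hsum : θ = ∑ i, B.repr ⟨θ, hθ⟩ i • (B i).1 := by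
      have := congrArg Subtype.val (B.sum_repr ⟨θ, hθ⟩)
      rw [Submodule.coe_sum] at this
      exact this.symm
    change LinearMap.baseChangeHom K F S S θ ∈ _
    rw [hsum, map_sum]
    refine Submodule.sum_mem _ fun i _ => ?_
    rw [map_smul, ← algebraMap_smul F]
    exact Submodule.smul_mem _ _ (Submodule.subset_span ⟨i, rfl⟩)
  exact (Submodule.finrank_mono hle).trans ((finrank_range_le_card _).trans (by simp))

end Centroid

section Semisimple

open LieAlgebra Module

variable {F L : Type*} [Field F] [LieRing L] [LieAlgebra F L]

/-- The projection onto an ideal along a complementary ideal lies in the centroid. -/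
theorem projection_mem_centroid {I J : LieIdeal F L}
    (h : IsCompl I.toSubmodule J.toSubmodule) : I.toSubmodule.projection _ h ∈ centroid F L := by
  intro x y
  have hy : y ∈ I.toSubmodule ⊔ J.toSubmodule := h.sup_eq_top ▸ Submodule.mem_top
  obtain ⟨u, hu, v, hv, rfl⟩ := Submodule.mem_sup.mp hy
  rw [lie_add, map_add, map_add, Submodule.projection_apply_of_mem_left h hu,
    Submodule.projection_apply_of_mem_right h hv,
    Submodule.projection_apply_of_mem_left h (lie_mem_right F L I x u hu),
    Submodule.projection_apply_of_mem_right h (lie_mem_right F L J x v hv), add_zero, add_zero]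

variable [FiniteDimensional F L] [IsSemisimple F L]

theorem LieAlgebra.IsSemisimple.finite_setOf_isAtom : {I : LieIdeal F L | IsAtom I}.Finite :=
  WellFoundedGT.finite_of_sSupIndep IsSemisimple.sSupIndep_isAtom

/-- A semisimple Lie algebra has at most as many simple ideals as the dimension of its
centroid. -/
theorem LieAlgebra.IsSemisimple.ncard_isAtom_le :
    {I : LieIdeal F L | IsAtom I}.ncard ≤ finrank F (centroid F L) := by
  classical
  set A := {I : LieIdeal F L | IsAtom I}
  have : Fintype A := IsSemisimple.finite_setOf_isAtom.fintype
  have hc (I : A) : IsCompl I.1.toSubmodule (sSup (A \ {I.1})).toSubmodule := by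
    have h : IsCompl I.1 (sSup (A \ {I.1})) := by
      refine ⟨IsSemisimple.sSupIndep_isAtom I.2, codisjoint_iff.mpr ?_⟩
      rw [← sSup_insert, Set.insert_sdiff_singleton, Set.insert_eq_of_mem I.2]
      exact IsSemisimple.sSup_atoms_eq_top
    rwa [LieSubmodule.isCompl_toSubmodule]
  have hli : LinearIndependent F fun I : A =>
      (⟨_, projection_mem_centroid (hc I)⟩ : centroid F L) := by
    rw [Fintype.linearIndependent_iff]
    intro g hg I
    obtain ⟨v, hv, hv0⟩ := Submodule.exists_mem_ne_zero_of_ne_bot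
      (mt (LieSubmodule.toSubmodule_eq_bot I.1).mp I.2.1)
    have h := congrArg (fun θ : centroid F L => θ.1 v) hg
    simp only [Submodule.coe_sum, Submodule.coe_smul, LinearMap.sum_apply, LinearMap.smul_apply,
      Submodule.coe_zero, LinearMap.zero_apply] at h
    rw [Finset.sum_eq_single I, Submodule.projection_apply_of_mem_left _ hv] at h
    · exact (smul_eq_zero.mp h).resolve_right hv0
    · intro J _ hJ
      rw [Submodule.projection_apply_of_mem_right, smul_zero]
      have hI : I.1 ∈ A \ {J.1} := ⟨I.2, fun h => hJ (Subtype.ext h.symm)⟩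
      exact le_sSup hI hv
    · simp
  rw [← Nat.card_coe_set_eq, Nat.card_eq_fintype_card]
  exact hli.fintype_card_le_finrank

/-- A semisimple Lie algebra of large dimension relative to its centroid has a simple ideal of
large dimension. -/
theorem LieAlgebra.IsSemisimple.exists_isAtom_lt_finrank {C : ℕ}
    (h : C * finrank F (centroid F L) < finrank F L) :
    ∃ I : LieIdeal F L, IsAtom I ∧ C < finrank F I := by
  by_contra! hC
  set s := (IsSemisimple.finite_setOf_isAtom (F := F) (L := L)).toFinset
  have htop : ⨆ I ∈ s, I.toSubmodule = ⊤ := by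
    have := congrArg LieSubmodule.toSubmodule (IsSemisimple.sSup_atoms_eq_top (R := F) (L := L))
    rw [LieSubmodule.sSup_toSubmodule_eq_iSup] at this
    simpa [s] using this
  have hle := Submodule.finrank_biSup_le_sum (fun I : LieIdeal F L => I.toSubmodule) s
  rw [htop, finrank_top] at hle
  have hsum : ∑ I ∈ s, finrank F I.toSubmodule ≤ s.card * C :=
    Finset.sum_le_card_nsmul _ _ _ fun I hI => hC I (by simpa [s] using hI)
  have hcard : s.card ≤ finrank F (centroid F L) := by
    rw [← Set.ncard_eq_toFinset_card _ IsSemisimple.finite_setOf_isAtom]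
    exact IsSemisimple.ncard_isAtom_le
  have := Nat.mul_le_mul_right C hcard
  rw [mul_comm C] at h
  omega

end Semisimple

section Conclusion

open LieAlgebra Module

theorem LieHom.map_chainBracket {R L L' : Type*} [CommRing R] [LieRing L] [LieAlgebra R L]
    [LieRing L'] [LieAlgebra R L'] (f : L →ₗ⁅R⁆ L') (e : ℕ → L) (k i : ℕ) :
    f (chainBracket e i k) = chainBracket (f ∘ e) i k := by
  induction k generalizing i with
  | zero => rfl
  | succ k ih => simp [chainBracket, ih]

/-- The scalar extension to an algebraically closed field of a simple Lie algebra of large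
dimension relative to its centroid contains a long chain of elements, commuting when not
consecutive, whose iterated bracket does not vanish. -/
theorem LieAlgebra.IsSimple.exists_chain_baseChange {K S : Type*} [Field K] [CharZero K]
    [LieRing S] [LieAlgebra K S] [FiniteDimensional K S] [IsSimple K S]
    (F : Type*) [Field F] [Algebra K F] [IsAlgClosed F] {n : ℕ}
    (hn : (7 ^ n + 9 ^ 7 ^ n) * finrank K (centroid K S) < finrank K S) :
    ∃ e : ℕ → F ⊗[K] S,
      (∀ i j, i + 1 < j → j < n + 1 → ⁅e i, e j⁆ = 0) ∧ chainBracket e 0 n ≠ 0 := by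
  have : CharZero F := charZero_of_injective_algebraMap (algebraMap K F).injective
  have : IsKilling F (F ⊗[K] S) := IsKilling.baseChange
  obtain ⟨I, hI, hdim⟩ := IsSemisimple.exists_isAtom_lt_finrank (F := F) (L := F ⊗[K] S)
    (C := 7 ^ n + 9 ^ 7 ^ n) <| by
      rw [finrank_baseChange]
      exact (Nat.mul_le_mul_left _ finrank_centroid_baseChange_le).trans_lt hn
  have := IsSemisimple.isSimple_of_isAtom I hI
  obtain ⟨e, he, hne⟩ := IsSimple.exists_chain hdim
  refine ⟨I.incl ∘ e, fun i j hij hj => ?_, ?_⟩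
  · rw [Function.comp_apply, Function.comp_apply, ← LieHom.map_lie, he i j hij hj, map_zero]
  · rw [← LieHom.map_chainBracket]
    simpa using hne

end Conclusion

/-- Let `P ≠ 0` be a Lie polynomial in `m` variables and let `(s i)` be a
family of finite-dimensional simple Lie algebras whose dimension over the (K-dimension of
the) centroid tends to infinity. Then for all sufficiently large `i`, the Lie algebra `s i`
does not satisfy the identity `P`. -/
theorem simple_lie_algebras_eventually_fail_identity
    (K : Type*) [Field K] [CharZero K] (m : ℕ) (hm : 1 ≤ m)
    (P : FreeLieAlgebra K (Fin m)) (hP : P ≠ 0)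
    (s : ℕ → Type*) [∀ i, LieRing (s i)] [∀ i, LieAlgebra K (s i)]
    [∀ i, FiniteDimensional K (s i)] [∀ i, LieAlgebra.IsSimple K (s i)]
    (hdim : ∀ C : ℕ, ∃ N : ℕ, ∀ i, N ≤ i →
      C * Module.finrank K (centroid K (s i)) < Module.finrank K (s i)) :
    ∃ N : ℕ, ∀ i, N ≤ i →
      ∃ f : FreeLieAlgebra K (Fin m) →ₗ⁅K⁆ s i, f P ≠ 0 := by
  obtain ⟨n, hn⟩ := FreeLieAlgebra.exists_lift_ne_zero hP
  obtain ⟨N, hN⟩ := hdim (7 ^ n + 9 ^ 7 ^ n)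
  refine ⟨N, fun i hi => ?_⟩
  by_contra! hall
  obtain ⟨e, he, hne⟩ := LieAlgebra.IsSimple.exists_chain_baseChange (AlgebraicClosure K) (hN i hi)
  obtain ⟨I, f, hf⟩ := hn e he hne
  exact hf (FreeLieAlgebra.apply_eq_zero_of_baseChange
    (fun g => FreeLieAlgebra.apply_eq_zero_of_baseChange hall g) f)
end
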